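/- Weighted a priori estimate for elliptic operators asymptotic to the Laplacian on ℝ³: Let s₀ ∈ ℕ with s₀ ≥ 4, δ₀ > −3/2, λ > 0, M > 0, and let s ∈ ℕ with 2 ≤ s ≤ s₀ and δ ∈ ℝ with −3/2 < δ < −1/2. Then there exist a constant C > 0 and a radius r > 0, depending only on s₀, δ₀, s, δ, λ and M, with the following property: for all smooth coefficients on ℝ³ — a symmetric-matrix-valued a₂ with λ|ξ|² ≤ a₂^{ij}(x)ξᵢξⱼ ≤ λ⁻¹|ξ|² for all x, ξ, and ‖a₂ − I‖_{H_{s₀+1,δ₀}(ℝ³)} ≤ M, a vector-valued a₁ with ‖a₁‖_{H_{s₀,δ₀+1}(ℝ³)} ≤ M, and a scalar a₀ with ‖a₀‖_{H_{s₀−1,δ₀+2}(ℝ³)} ≤ M — and for every smooth u : ℝ³ → ℝ with ‖u‖_{H_{s,δ−1}(ℝ³)} < ∞, one has ‖u‖_{H_{s,δ−1}(ℝ³)} ≤ C ( ‖Lu‖_{H_{s−2,δ+1}(ℝ³)} + ‖u‖_{H_{s−2}(B_{2r})} ), where Lu = Σ_{i,j} a₂^{ij} ∂ᵢ∂ⱼu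 + Σ_i a₁^{i} ∂ᵢu + a₀ u and ‖u‖_{H_{s−2}(B_{2r})} is the standard (unweighted) L² Sobolev norm of order s−2 on the ball of radius 2r. -/

import Mathlib

open MeasureTheory

/-- The weighted Sobolev norm `‖u‖_{H_{s,δ}(ℝ³)}`, valued in `ℝ≥0∞`. -/
noncomputable def wSob (s : ℕ) (δ : ℝ) (u : EuclideanSpace ℝ (Fin 3) → ℝ) : ENNReal :=
  (∑ k ∈ Finset.range (s + 1),
    ∫⁻ x : EuclideanSpace ℝ (Fin 3),
      ENNReal.ofReal ((1 + ‖x‖ ^ 2) ^ (δ + (k : ℝ)) * ‖iteratedFDeriv ℝ k u x‖ ^ 2)) ^ (1/2 : ℝ)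

/-- The standard (unweighted) Sobolev norm of order `s` on the ball `B_r ⊆ ℝ³`. -/
noncomputable def sobBall (s : ℕ) (r : ℝ) (u : EuclideanSpace ℝ (Fin 3) → ℝ) : ENNReal :=
  (∑ k ∈ Finset.range (s + 1),
    ∫⁻ x in Metric.ball (0 : EuclideanSpace ℝ (Fin 3)) r,
      ENNReal.ofReal (‖iteratedFDeriv ℝ k u x‖ ^ 2)) ^ (1/2 : ℝ)

/-- The partial derivative `∂ᵢ` on `ℝ³`. -/
noncomputable def pd (i : Fin 3) (u : EuclideanSpace ℝ (Fin 3) → ℝ) :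
    EuclideanSpace ℝ (Fin 3) → ℝ :=
  fun x => fderiv ℝ u x (EuclideanSpace.single i 1)

/-- The elliptic operator `Lu = Σ a₂^{ij} ∂ᵢ∂ⱼu + Σ a₁^{i} ∂ᵢu + a₀ u`. -/
noncomputable def ellOp (a₂ : EuclideanSpace ℝ (Fin 3) → Matrix (Fin 3) (Fin 3) ℝ)
    (a₁ : EuclideanSpace ℝ (Fin 3) → Fin 3 → ℝ) (a₀ : EuclideanSpace ℝ (Fin 3) → ℝ)
    (u : EuclideanSpace ℝ (Fin 3) → ℝ) : EuclideanSpace ℝ (Fin 3) → ℝ :=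
  fun x => (∑ i : Fin 3, ∑ j : Fin 3, a₂ x i j * pd i (pd j u) x)
    + (∑ i : Fin 3, a₁ x i * pd i u x) + a₀ x * u x

namespace WeightedSobolev

/-- Euclidean three-space. -/
abbrev E3 := EuclideanSpace ℝ (Fin 3)

/-- Smooth real-valued functions on `ℝ³`. -/
abbrev Smooth (f : E3 → ℝ) : Prop := ContDiff ℝ (⊤ : ℕ∞) f

/-- The squared weight `σ² = 1 + |x|²`. -/
noncomputable def q (x : E3) : ℝ := 1 + ‖x‖ ^ 2

lemma one_le_q (x : E3) : 1 ≤ q x := by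
  unfold q; nlinarith [sq_nonneg ‖x‖]

lemma q_pos (x : E3) : 0 < q x := by linarith [one_le_q x]

lemma q_rpow_pos (t : ℝ) (x : E3) : 0 < q x ^ t := Real.rpow_pos_of_pos (q_pos x) t

lemma q_rpow_add (s t : ℝ) (x : E3) : q x ^ (s + t) = q x ^ s * q x ^ t :=
  Real.rpow_add (q_pos x) s t

lemma q_rpow_mono {s t : ℝ} (h : s ≤ t) (x : E3) : q x ^ s ≤ q x ^ t :=
  Real.rpow_le_rpow_of_exponent_le (one_le_q x) h

lemma q_rpow_half_sq (t : ℝ) (x : E3) : (q x ^ (t / 2)) ^ 2 = q x ^ t := by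
  rw [← Real.rpow_natCast, ← Real.rpow_mul (q_pos x).le]
  norm_num

lemma q_eq_sum (x : E3) : q x = 1 + ∑ i, x i ^ 2 := by
  simp [q, EuclideanSpace.norm_sq_eq]

lemma smooth_q : Smooth q := contDiff_const.add (contDiff_norm_sq ℝ)

lemma smooth_q_rpow (t : ℝ) : Smooth (fun x => q x ^ t) :=
  smooth_q.rpow_const_of_ne fun x => (q_pos x).ne'

lemma smooth_coord (i : Fin 3) : Smooth (fun x => x i) :=
  (EuclideanSpace.proj (𝕜 := ℝ) i).contDiff

lemma abs_coord_le (x : E3) (i : Fin 3) : |x i| ≤ q x ^ (1 / 2 : ℝ) := by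
  rw [← Real.sqrt_eq_rpow]
  apply Real.abs_le_sqrt
  rw [q_eq_sum]
  have := Finset.single_le_sum (f := fun i => x i ^ 2) (fun j _ => sq_nonneg (x j))
    (Finset.mem_univ i)
  simp only at this
  linarith

lemma Smooth.diffAt {f : E3 → ℝ} (hf : Smooth f) (x : E3) : DifferentiableAt ℝ f x :=
  (hf.differentiable (by simp)) x

lemma Smooth.pd {f : E3 → ℝ} (hf : Smooth f) (i : Fin 3) : Smooth (pd i f) := by
  unfold _root_.pd
  exact (hf.fderiv_right (m := (⊤ : ℕ∞)) (by simp)).clm_apply contDiff_const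

lemma Smooth.sum {ι : Type*} {s : Finset ι} {f : ι → E3 → ℝ} (h : ∀ i ∈ s, Smooth (f i)) :
    Smooth (fun x => ∑ i ∈ s, f i x) := ContDiff.sum h

lemma pd_mul {f g : E3 → ℝ} (hf : Smooth f) (hg : Smooth g) (i : Fin 3) (x : E3) :
    pd i (fun x => f x * g x) x = pd i f x * g x + f x * pd i g x := by
  unfold pd
  rw [fderiv_fun_mul (hf.diffAt x) (hg.diffAt x)]
  simp; ring

lemma pd_add {f g : E3 → ℝ} (hf : Smooth f) (hg : Smooth g) (i : Fin 3) (x : E3) :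
    pd i (fun x => f x + g x) x = pd i f x + pd i g x := by
  unfold pd
  rw [fderiv_fun_add (hf.diffAt x) (hg.diffAt x)]
  simp

lemma pd_sub_const (f : E3 → ℝ) (c : ℝ) (i : Fin 3) (x : E3) :
    pd i (fun x => f x - c) x = pd i f x := by
  unfold pd
  rw [fderiv_sub_const]

lemma pd_sum {ι : Type*} {s : Finset ι} {f : ι → E3 → ℝ} (h : ∀ i ∈ s, Smooth (f i)) (i : Fin 3)
    (x : E3) : pd i (fun x => ∑ j ∈ s, f j x) x = ∑ j ∈ s, pd i (f j) x := by
  unfold pd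
  rw [fderiv_fun_sum (fun j hj => (h j hj).diffAt x)]
  simp

lemma pd_comm {f : E3 → ℝ} (hf : Smooth f) (i j : Fin 3) (x : E3) :
    pd i (pd j f) x = pd j (pd i f) x := by
  have hd : DifferentiableAt ℝ (fderiv ℝ f) x :=
    ((hf.fderiv_right (m := (⊤ : ℕ∞)) (by simp)).differentiable (by simp)) x
  have key : ∀ a b : Fin 3, pd a (pd b f) x =
      fderiv ℝ (fderiv ℝ f) x (EuclideanSpace.single a 1) (EuclideanSpace.single b 1) := by
    intro a b
    unfold pd
    rw [fderiv_clm_apply hd (differentiableAt_const _)]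
    simp
  rw [key, key]
  have hs : IsSymmSndFDerivAt ℝ f x :=
    (hf.contDiffAt).isSymmSndFDerivAt (by
      simp only [minSmoothness_of_isRCLikeNormedField]
      exact WithTop.coe_le_coe.2 le_top)
  exact hs _ _

lemma pd_coord (i j : Fin 3) (x : E3) :
    pd i (fun x => x j) x = if i = j then 1 else 0 := by
  unfold pd
  have : fderiv ℝ (fun x : E3 => x j) x = EuclideanSpace.proj (𝕜 := ℝ) j :=
    (EuclideanSpace.proj (𝕜 := ℝ) j).fderiv
  rw [this]
  simp [eq_comm]

lemma pd_q_rpow (t : ℝ) (i : Fin 3) (x : E3) :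
    pd i (fun x => q x ^ t) x = 2 * t * x i * q x ^ (t - 1) := by
  unfold pd
  have h1 : HasFDerivAt q (2 • (innerSL ℝ x)) x := by
    exact ((hasStrictFDerivAt_norm_sq x).hasFDerivAt).const_add 1
  have h2 := h1.rpow_const (p := t) (Or.inl (q_pos x).ne')
  rw [h2.fderiv]
  simp [innerSL_apply_apply, PiLp.inner_apply]
  ring

lemma integral_mul_pd_eq_neg {χ f : E3 → ℝ} (hχ : Smooth χ) (hf : Smooth f)
    (hc : HasCompactSupport χ) (i : Fin 3) :
    Integrable (fun x => χ x * pd i f x) ∧ Integrable (fun x => pd i χ x * f x) ∧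
    ∫ x, χ x * pd i f x = -∫ x, pd i χ x * f x := by
  have hc' : HasCompactSupport (pd i χ) := hc.fderiv_apply (𝕜 := ℝ) _
  have h1 : Integrable (fun x => χ x * pd i f x) :=
    (hχ.continuous.mul (hf.pd i).continuous).integrable_of_hasCompactSupport hc.mul_right
  have h2 : Integrable (fun x => pd i χ x * f x) :=
    ((hχ.pd i).continuous.mul hf.continuous).integrable_of_hasCompactSupport hc'.mul_right
  have h3 : Integrable (fun x => χ x * f x) :=
    (hχ.continuous.mul hf.continuous).integrable_of_hasCompactSupport hc.mul_right
  exact ⟨h1, h2, integral_mul_fderiv_eq_neg_fderiv_mul_of_integrable h2 h1 h3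
    (fun x _ => hχ.diffAt x) (fun x _ => hf.diffAt x)⟩

/-- Smooth cutoffs exhausting `ℝ³` with gradient bounded by a multiple of `σ⁻¹`. -/
lemma exists_cutoff : ∃ (C : ℝ) (χ : ℕ → E3 → ℝ), 0 ≤ C ∧ (∀ n, Smooth (χ n)) ∧
    (∀ n, HasCompactSupport (χ n)) ∧ (∀ n x, |χ n x| ≤ 1) ∧
    (∀ n i x, |pd i (χ n) x| ≤ C * q x ^ (-(1 / 2) : ℝ)) ∧
    (∀ x, ∀ᶠ n in Filter.atTop, χ n x = 1 ∧ ∀ i, pd i (χ n) x = 0) := by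
  let f : ContDiffBump (0 : E3) := ⟨1, 2, by norm_num, by norm_num⟩
  have hfs : ContDiff ℝ (⊤ : ℕ∞) f := f.contDiff
  have hfc : HasCompactSupport (fderiv ℝ f) := f.hasCompactSupport.fderiv (𝕜 := ℝ)
  obtain ⟨C, hC⟩ := (hfs.continuous_fderiv (by simp)).bounded_above_of_compact_support hfc
  have hC0 : 0 ≤ C := (norm_nonneg _).trans (hC 0)
  let c : ℕ → ℝ := fun n => ((n : ℝ) + 1)⁻¹
  have hcpos : ∀ n, 0 < c n := fun n => by positivity
  let χ : ℕ → E3 → ℝ := fun n x => f (c n • x)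
  have hχs : ∀ n, Smooth (χ n) := fun n => hfs.comp (contDiff_const_smul (c n))
  have hpd : ∀ n i x, pd i (χ n) x = c n * fderiv ℝ f (c n • x) (EuclideanSpace.single i 1) := by
    intro n i x
    unfold pd
    have : HasFDerivAt (χ n) ((fderiv ℝ f (c n • x)).comp (c n • ContinuousLinearMap.id ℝ E3)) x :=
      ((hfs.differentiable (by simp)) (c n • x)).hasFDerivAt.comp x
        ((hasFDerivAt_id x).const_smul (c n))
    rw [this.fderiv]
    simp
  have hone : ∀ (n : ℕ) x, ‖x‖ < (n : ℝ) + 1 → χ n x = 1 := by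
    intro n x hx
    apply f.one_of_mem_closedBall
    simp only [Metric.mem_closedBall, dist_zero_right, norm_smul, Real.norm_eq_abs,
      abs_of_pos (hcpos n)]
    change ((n : ℝ) + 1)⁻¹ * ‖x‖ ≤ 1
    rw [inv_mul_le_one₀ (by positivity)]
    exact hx.le
  refine ⟨3 * C, χ, by positivity, hχs, ?_, ?_, ?_, ?_⟩
  · intro n
    exact f.hasCompactSupport.comp_homeomorph (Homeomorph.smulOfNeZero (c n) (hcpos n).ne')
  · intro n x
    rw [abs_of_nonneg f.nonneg]
    exact f.le_one
  · intro n i x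
    rw [hpd, abs_mul, abs_of_pos (hcpos n)]
    by_cases hx : ‖x‖ ≤ 2 * ((n : ℝ) + 1)
    · have h1 : |fderiv ℝ f (c n • x) (EuclideanSpace.single i 1)| ≤ C := by
        have := (fderiv ℝ f (c n • x)).le_opNorm (EuclideanSpace.single i 1)
        simp only [PiLp.norm_single, norm_one, mul_one] at this
        exact this.trans (hC _)
      have h2 : c n ≤ 3 * q x ^ (-(1 / 2) : ℝ) := by
        rw [Real.rpow_neg (q_pos x).le, ← Real.sqrt_eq_rpow]
        have hs : √(q x) ≤ 3 * ((n : ℝ) + 1) := by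
          apply Real.sqrt_le_iff.2 ⟨by positivity, ?_⟩
          unfold q
          have : (1 : ℝ) ≤ (n : ℝ) + 1 := by linarith [Nat.cast_nonneg (α := ℝ) n]
          nlinarith [norm_nonneg x]
        have hq : 0 < √(q x) := Real.sqrt_pos.2 (q_pos x)
        change ((n : ℝ) + 1)⁻¹ ≤ _
        rw [← div_eq_mul_inv, le_div_iff₀ hq, inv_mul_le_iff₀ (by positivity)]
        linarith
      calc c n * |fderiv ℝ f (c n • x) (EuclideanSpace.single i 1)|
          ≤ (3 * q x ^ (-(1 / 2) : ℝ)) * C :=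
            mul_le_mul h2 h1 (abs_nonneg _) (by have := q_rpow_pos (-(1 / 2)) x; positivity)
        _ = _ := by ring
    · have h0 : fderiv ℝ f (c n • x) = 0 := by
        have : c n • x ∉ tsupport f := by
          rw [f.tsupport_eq]
          simp only [Metric.mem_closedBall, dist_zero_right, norm_smul, Real.norm_eq_abs,
            abs_of_pos (hcpos n), not_le]
          change 2 < ((n : ℝ) + 1)⁻¹ * ‖x‖
          rw [lt_inv_mul_iff₀ (by positivity)]
          linarith
        exact fderiv_of_notMem_tsupport (𝕜 := ℝ) this
      rw [h0]
      have := q_rpow_pos (-(1 / 2)) x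
      simp only [zero_apply, abs_zero, mul_zero]
      positivity
  · intro x
    obtain ⟨N, hN⟩ := exists_nat_gt ‖x‖
    filter_upwards [Filter.eventually_ge_atTop N] with n hn
    have hx : ‖x‖ < (n : ℝ) + 1 := by
      have : (N : ℝ) ≤ n := by exact_mod_cast hn
      linarith
    refine ⟨hone n x hx, fun i => ?_⟩
    have : χ n =ᶠ[nhds x] fun _ => 1 := by
      filter_upwards [(isOpen_lt continuous_norm continuous_const).mem_nhds hx] with y hy
      exact hone n y hy
    unfold pd
    rw [this.fderiv_eq]
    simp

/-- Divergence theorem on `ℝ³` for smooth fields `F` with `σ⁻¹ F` integrable. -/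
lemma integral_div_eq_zero {F : Fin 3 → E3 → ℝ} (hF : ∀ i, Smooth (F i))
    (hint : ∀ i, Integrable (fun x => q x ^ (-(1 / 2) : ℝ) * F i x))
    (hdiv : Integrable (fun x => ∑ i, pd i (F i) x)) :
    ∫ x, ∑ i, pd i (F i) x = 0 := by
  obtain ⟨C, χ, hC, hχs, hχc, hχ1, hχd, hχe⟩ := exists_cutoff
  have hn : ∀ n, ∫ x, χ n x * ∑ i, pd i (F i) x = ∫ x, -∑ i, pd i (χ n) x * F i x := by
    intro n
    have h := fun i => integral_mul_pd_eq_neg (hχs n) (hF i) (hχc n) i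
    simp_rw [Finset.mul_sum]
    rw [integral_finsetSum _ (fun i _ => (h i).1), integral_neg,
      integral_finsetSum _ (fun i _ => (h i).2.1), ← Finset.sum_neg_distrib]
    exact Finset.sum_congr rfl fun i _ => (h i).2.2
  have hdivc : Continuous (fun x => ∑ i, pd i (F i) x) :=
    continuous_finsetSum _ fun i _ => ((hF i).pd i).continuous
  have l1 : Filter.Tendsto (fun n => ∫ x, χ n x * ∑ i, pd i (F i) x) Filter.atTop
      (nhds (∫ x, ∑ i, pd i (F i) x)) := by
    refine tendsto_integral_of_dominated_convergence (fun x => |∑ i, pd i (F i) x|) ?_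
      hdiv.abs ?_ ?_
    · exact fun n => ((hχs n).continuous.mul hdivc).aestronglyMeasurable
    · refine fun n => Filter.Eventually.of_forall fun x => ?_
      rw [Real.norm_eq_abs, abs_mul]
      exact mul_le_of_le_one_left (abs_nonneg _) (hχ1 n x)
    · refine Filter.Eventually.of_forall fun x => tendsto_const_nhds.congr' ?_
      filter_upwards [hχe x] with n hx
      rw [hx.1, one_mul]
  have l2 : Filter.Tendsto (fun n => ∫ x, -∑ i, pd i (χ n) x * F i x) Filter.atTop
      (nhds (∫ _ : E3, (0 : ℝ))) := by
    refine tendsto_integral_of_dominated_convergence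
      (fun x => ∑ i, C * |q x ^ (-(1 / 2) : ℝ) * F i x|) ?_
      (integrable_finsetSum _ fun i _ => ((hint i).abs.const_mul C)) ?_ ?_
    · exact fun n => (continuous_finsetSum _ fun i _ =>
        (((hχs n).pd i).continuous.mul (hF i).continuous)).neg.aestronglyMeasurable
    · refine fun n => Filter.Eventually.of_forall fun x => ?_
      rw [Real.norm_eq_abs, abs_neg]
      refine (Finset.abs_sum_le_sum_abs _ _).trans (Finset.sum_le_sum fun i _ => ?_)
      rw [abs_mul, abs_mul, abs_of_pos (q_rpow_pos _ x), ← mul_assoc]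
      exact mul_le_mul_of_nonneg_right (hχd n i x) (abs_nonneg _)
    · refine Filter.Eventually.of_forall fun x => tendsto_const_nhds.congr' ?_
      filter_upwards [hχe x] with n hx
      simp [hx.2]
  simp_rw [hn] at l1
  simpa using tendsto_nhds_unique l1 l2

/-- Square integrability against the weight `q ^ t`. -/
def L2w (t : ℝ) (f : E3 → ℝ) : Prop := Integrable (fun x => q x ^ t * f x ^ 2)

lemma weighted_amgm {s t p η : ℝ} (hη : 0 < η) (h : s + t = 2 * p) (x : E3) (a b : ℝ) :
    q x ^ p * (|a| * |b|) ≤ η * (q x ^ s * a ^ 2) + (1 / (4 * η)) * (q x ^ t * b ^ 2) := by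
  have hp : q x ^ p = q x ^ (s / 2) * q x ^ (t / 2) := by
    rw [← q_rpow_add]; congr 1; linarith
  rw [hp, ← q_rpow_half_sq s, ← q_rpow_half_sq t, ← sq_abs a, ← sq_abs b]
  set A := q x ^ (s / 2) * |a|
  set B := q x ^ (t / 2) * |b|
  have h1 : η * A ^ 2 + 1 / (4 * η) * B ^ 2 - A * B = (2 * η * A - B) ^ 2 / (4 * η) := by
    field_simp; ring
  have h2 : 0 ≤ (2 * η * A - B) ^ 2 / (4 * η) := by positivity
  nlinarith

lemma integrable_of_le_mul {s t p K : ℝ} {f g h : E3 → ℝ} (hf : L2w s f) (hg : L2w t g)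
    (hst : s + t = 2 * p) (hK : 0 ≤ K) (hh : Continuous h)
    (hb : ∀ x, |h x| ≤ K * (q x ^ p * (|f x| * |g x|))) : Integrable h := by
  refine ((hf.add hg).const_mul K).mono' hh.aestronglyMeasurable
    (Filter.Eventually.of_forall fun x => (hb x).trans ?_)
  refine mul_le_mul_of_nonneg_left ?_ hK
  have h1 := weighted_amgm (η := 1) one_pos hst x (f x) (g x)
  have h2 : 0 ≤ q x ^ t * g x ^ 2 := by have := q_rpow_pos t x; positivity
  simp only [Pi.add_apply]
  linarith

lemma integral_pd_add_pd_eq_zero {A B : E3 → ℝ} (hA : Smooth A) (hB : Smooth B) (i k : Fin 3)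
    (hAi : Integrable (fun x => q x ^ (-(1 / 2) : ℝ) * A x))
    (hBi : Integrable (fun x => q x ^ (-(1 / 2) : ℝ) * B x))
    (hd : Integrable (fun x => pd i A x + pd k B x)) :
    ∫ x, (pd i A x + pd k B x) = 0 := by
  have h0 : Smooth (fun _ => (0 : ℝ)) := contDiff_const
  have hsA : ∀ l, Smooth (fun x => if l = i then A x else 0) := fun l => by
    by_cases h : l = i <;> simp [h, hA, h0]
  have hsB : ∀ l, Smooth (fun x => if l = k then B x else 0) := fun l => by
    by_cases h : l = k <;> simp [h, hB, h0]
  have hpd : ∀ x, ∑ l, pd l (fun x => (if l = i then A x else 0) + (if l = k then B x else 0)) x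
      = pd i A x + pd k B x := by
    intro x
    have hA' : ∀ l, pd l (fun x => if l = i then A x else 0) x = if l = i then pd i A x else 0 := by
      intro l
      by_cases h : l = i
      · simp [h]
      · simp [h, pd]
    have hB' : ∀ l, pd l (fun x => if l = k then B x else 0) x = if l = k then pd k B x else 0 := by
      intro l
      by_cases h : l = k
      · simp [h]
      · simp [h, pd]
    simp_rw [fun l => pd_add (hsA l) (hsB l) l x, hA', hB', Finset.sum_add_distrib]
    simp
  have := integral_div_eq_zero
    (F := fun l x => (if l = i then A x else 0) + (if l = k then B x else 0))
    (fun l => (hsA l).add (hsB l))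
    (fun l => by
      simp_rw [mul_add]
      refine Integrable.add ?_ ?_
      · by_cases h : l = i
        · simpa [h] using hAi
        · simp [h]
      · by_cases h : l = k
        · simpa [h] using hBi
        · simp [h])
    (by simpa only [hpd] using hd)
  simpa only [hpd] using this

/-- The null form `∂ₖv ∂ᵢw - ∂ᵢv ∂ₖw` integrates to lower order terms. -/
lemma integral_null_form {t K : ℝ} {b v w : E3 → ℝ} (hb : Smooth b) (hv : Smooth v)
    (hw : Smooth w) (hK : 0 ≤ K) (i k : Fin 3) (hb0 : ∀ x, |b x| ≤ K * q x ^ t)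
    (hb1 : ∀ l x, |pd l b x| ≤ K * q x ^ (t - 1 / 2)) (hv1 : ∀ l, L2w t (pd l v))
    (hw1 : ∀ l, L2w t (pd l w)) (hw0 : L2w (t - 1) w) :
    Integrable (fun x => b x * (pd k v x * pd i w x - pd i v x * pd k w x)
      + (pd i b x * pd k v x - pd k b x * pd i v x) * w x) ∧
    ∫ x, (b x * (pd k v x * pd i w x - pd i v x * pd k w x)
      + (pd i b x * pd k v x - pd k b x * pd i v x) * w x) = 0 := by
  have i1 : ∀ l m, Integrable (fun x => b x * (pd l v x * pd m w x)) := fun l m => by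
    refine integrable_of_le_mul (hv1 l) (hw1 m) (p := t) (by ring) hK
      (hb.continuous.mul ((hv.pd l).continuous.mul (hw.pd m).continuous)) fun x => ?_
    rw [abs_mul, abs_mul, ← mul_assoc K]
    exact mul_le_mul_of_nonneg_right (hb0 x) (by positivity)
  have i2 : ∀ l m, Integrable (fun x => pd l b x * (pd m v x * w x)) := fun l m => by
    refine integrable_of_le_mul (hv1 m) hw0 (p := t - 1 / 2) (by ring) hK
      ((hb.pd l).continuous.mul ((hv.pd m).continuous.mul hw.continuous)) fun x => ?_
    rw [abs_mul, abs_mul, ← mul_assoc K]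
    exact mul_le_mul_of_nonneg_right (hb1 l x) (by positivity)
  have i3 : ∀ m, Integrable (fun x => q x ^ (-(1 / 2) : ℝ) * (b x * (pd m v x * w x))) := fun m => by
    refine integrable_of_le_mul (hv1 m) hw0 (p := t - 1 / 2) (by ring) hK
      ((smooth_q_rpow _).continuous.mul
        (hb.continuous.mul ((hv.pd m).continuous.mul hw.continuous))) fun x => ?_
    rw [abs_mul, abs_mul, abs_mul, abs_of_pos (q_rpow_pos _ x), ← mul_assoc (q x ^ _),
      ← mul_assoc K]
    refine mul_le_mul_of_nonneg_right ?_ (by positivity)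
    have : q x ^ (t - 1 / 2) = q x ^ (-(1 / 2) : ℝ) * q x ^ t := by
      rw [← q_rpow_add]; congr 1; ring
    rw [this]
    nlinarith [hb0 x, q_rpow_pos (-(1 / 2)) x]
  have hA : Smooth (fun x => b x * (pd k v x * w x)) := hb.mul ((hv.pd k).mul hw)
  have hB' : Smooth (fun x => b x * (pd i v x * w x)) := hb.mul ((hv.pd i).mul hw)
  have hB : Smooth (fun x => -(b x * (pd i v x * w x))) := hB'.neg
  have hid : ∀ x, pd i (fun x => b x * (pd k v x * w x)) x
      + pd k (fun x => -(b x * (pd i v x * w x))) x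
      = b x * (pd k v x * pd i w x - pd i v x * pd k w x)
      + (pd i b x * pd k v x - pd k b x * pd i v x) * w x := by
    intro x
    have hn : pd k (fun x => -(b x * (pd i v x * w x))) x
        = -pd k (fun x => b x * (pd i v x * w x)) x := by
      unfold pd; rw [fderiv_fun_neg]; simp
    rw [hn, pd_mul hb ((hv.pd k).mul hw), pd_mul hb ((hv.pd i).mul hw), pd_mul (hv.pd k) hw,
      pd_mul (hv.pd i) hw, pd_comm hv i k]
    ring
  have hint : Integrable (fun x => b x * (pd k v x * pd i w x - pd i v x * pd k w x)
      + (pd i b x * pd k v x - pd k b x * pd i v x) * w x) := by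
    refine ((((i1 k i).sub (i1 i k)).add (i2 i k)).sub (i2 k i)).congr
      (Filter.Eventually.of_forall fun x => ?_)
    simp only [Pi.sub_apply, Pi.add_apply]
    ring
  refine ⟨hint, ?_⟩
  have := integral_pd_add_pd_eq_zero hA hB i k (i3 k)
    ((i3 i).neg.congr (Filter.Eventually.of_forall fun x => by simp))
    (by simpa only [hid] using hint)
  simpa only [hid] using this

/-- The radial identity behind the weighted Hardy inequality. -/
lemma integral_radial {t : ℝ} {w : E3 → ℝ} (hw : Smooth w) (hw0 : L2w (t - 1) w)
    (hw1 : ∀ l, L2w t (pd l w)) :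
    Integrable (fun x => (2 * t + 1) * (q x ^ (t - 1) * w x ^ 2)
      - (2 * t - 2) * (q x ^ (t - 2) * w x ^ 2)
      + 2 * (q x ^ (t - 1) * (w x * ∑ i, x i * pd i w x))) ∧
    ∫ x, ((2 * t + 1) * (q x ^ (t - 1) * w x ^ 2) - (2 * t - 2) * (q x ^ (t - 2) * w x ^ 2)
      + 2 * (q x ^ (t - 1) * (w x * ∑ i, x i * pd i w x))) = 0 := by
  have hs : ∀ i, Smooth (fun x => q x ^ (t - 1) * (x i * (w x * w x))) := fun i =>
    (smooth_q_rpow _).mul ((smooth_coord i).mul (hw.mul hw))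
  have hid : ∀ x, ∑ i, pd i (fun x => q x ^ (t - 1) * (x i * (w x * w x))) x
      = (2 * t + 1) * (q x ^ (t - 1) * w x ^ 2) - (2 * t - 2) * (q x ^ (t - 2) * w x ^ 2)
      + 2 * (q x ^ (t - 1) * (w x * ∑ i, x i * pd i w x)) := by
    intro x
    have h1 : ∀ i, pd i (fun x => q x ^ (t - 1) * (x i * (w x * w x))) x
        = q x ^ (t - 1) * w x ^ 2 + (2 * t - 2) * q x ^ (t - 2) * w x ^ 2 * (x i ^ 2)
          + 2 * q x ^ (t - 1) * w x * (x i * pd i w x) := by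
      intro i
      rw [pd_mul (smooth_q_rpow _) ((smooth_coord i).mul (hw.mul hw)),
        pd_mul (smooth_coord i) (hw.mul hw), pd_mul hw hw, pd_coord, pd_q_rpow,
        show t - 1 - 1 = t - 2 by ring, if_pos rfl]
      ring
    simp_rw [h1, Finset.sum_add_distrib, ← Finset.mul_sum]
    have h2 : ∑ i, x i ^ 2 = q x - 1 := by rw [q_eq_sum]; ring
    have h3 : q x ^ (t - 1) = q x ^ (t - 2) * q x := by
      conv_rhs => rw [← Real.rpow_one (q x), ← Real.rpow_mul (q_pos x).le, one_mul, ← q_rpow_add]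
      congr 1; ring
    rw [h2]
    simp only [Finset.sum_const, Finset.card_univ, Fintype.card_fin]
    rw [h3]
    simp only [nsmul_eq_mul]
    push_cast
    ring
  have i1 : Integrable (fun x => q x ^ (t - 2) * w x ^ 2) := by
    refine integrable_of_le_mul hw0 hw0 (p := t - 1) (by ring) zero_le_one
      ((smooth_q_rpow _).continuous.mul (hw.continuous.pow 2)) fun x => ?_
    rw [abs_mul, abs_of_pos (q_rpow_pos _ x), one_mul, abs_pow, sq]
    exact mul_le_mul_of_nonneg_right (q_rpow_mono (by linarith) x) (by positivity)
  have i2 : ∀ i, Integrable (fun x => q x ^ (t - 1) * (w x * (x i * pd i w x))) := fun i => by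
    refine integrable_of_le_mul hw0 (hw1 i) (p := t - 1 / 2) (by ring) zero_le_one
      ((smooth_q_rpow _).continuous.mul (hw.continuous.mul
        ((smooth_coord i).continuous.mul (hw.pd i).continuous))) fun x => ?_
    rw [abs_mul, abs_mul, abs_mul, abs_of_pos (q_rpow_pos _ x), one_mul]
    have h1 : q x ^ (t - 1 / 2) = q x ^ (t - 1) * q x ^ (1 / 2 : ℝ) := by
      rw [← q_rpow_add]; congr 1; ring
    rw [h1]
    calc q x ^ (t - 1) * (|w x| * (|x i| * |pd i w x|))
        = (q x ^ (t - 1) * |x i|) * (|w x| * |pd i w x|) := by ring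
      _ ≤ _ := by
        refine mul_le_mul_of_nonneg_right ?_ (by positivity)
        exact mul_le_mul_of_nonneg_left (abs_coord_le x i) (q_rpow_pos _ x).le
  have hint : Integrable (fun x => (2 * t + 1) * (q x ^ (t - 1) * w x ^ 2)
      - (2 * t - 2) * (q x ^ (t - 2) * w x ^ 2)
      + 2 * (q x ^ (t - 1) * (w x * ∑ i, x i * pd i w x))) := by
    refine ((hw0.const_mul _).sub (i1.const_mul _)).add (Integrable.const_mul ?_ 2)
    simp_rw [Finset.mul_sum]
    exact integrable_finsetSum _ fun i _ => i2 i
  refine ⟨hint, ?_⟩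
  have := integral_div_eq_zero hs (fun i => by
    refine integrable_of_le_mul hw0 hw0 (p := t - 1) (by ring) zero_le_one
      ((smooth_q_rpow _).continuous.mul (hs i).continuous) fun x => ?_
    rw [abs_mul, abs_mul, abs_mul, abs_mul, abs_of_pos (q_rpow_pos _ x),
      abs_of_pos (q_rpow_pos _ x), one_mul]
    have h1 : q x ^ (-(1 / 2) : ℝ) * q x ^ (1 / 2 : ℝ) = 1 := by
      rw [← q_rpow_add]; norm_num
    calc q x ^ (-(1 / 2) : ℝ) * (q x ^ (t - 1) * (|x i| * (|w x| * |w x|)))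
        = (q x ^ (-(1 / 2) : ℝ) * |x i|) * (q x ^ (t - 1) * (|w x| * |w x|)) := by ring
      _ ≤ 1 * (q x ^ (t - 1) * (|w x| * |w x|)) := by
        have h2 := q_rpow_pos (t - 1) x
        refine mul_le_mul_of_nonneg_right ?_ (by positivity)
        exact (mul_le_mul_of_nonneg_left (abs_coord_le x i) (q_rpow_pos _ x).le).trans h1.le
      _ = _ := one_mul _) (by simpa only [hid] using hint)
  simpa only [hid] using this

/-- Integration by parts for `q ^ t w Δw`. -/
lemma integral_energy {t : ℝ} {w : E3 → ℝ} (hw : Smooth w) (hw0 : L2w (t - 1) w)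
    (hw1 : ∀ l, L2w t (pd l w)) (hw2 : ∀ l, L2w (t + 1) (pd l (pd l w))) :
    Integrable (fun x => ∑ i, (2 * t * x i * q x ^ (t - 1) * w x * pd i w x
      + q x ^ t * pd i w x ^ 2 + q x ^ t * (w x * pd i (pd i w) x))) ∧
    ∫ x, ∑ i, (2 * t * x i * q x ^ (t - 1) * w x * pd i w x
      + q x ^ t * pd i w x ^ 2 + q x ^ t * (w x * pd i (pd i w) x)) = 0 := by
  have hs : ∀ i, Smooth (fun x => q x ^ t * (w x * pd i w x)) := fun i =>
    (smooth_q_rpow _).mul (hw.mul (hw.pd i))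
  have hid : ∀ x, ∑ i, pd i (fun x => q x ^ t * (w x * pd i w x)) x
      = ∑ i, (2 * t * x i * q x ^ (t - 1) * w x * pd i w x
      + q x ^ t * pd i w x ^ 2 + q x ^ t * (w x * pd i (pd i w) x)) := by
    intro x
    refine Finset.sum_congr rfl fun i _ => ?_
    rw [pd_mul (smooth_q_rpow _) (hw.mul (hw.pd i)), pd_mul hw (hw.pd i), pd_q_rpow]
    ring
  have i2 : ∀ i, Integrable (fun x => 2 * t * x i * q x ^ (t - 1) * w x * pd i w x) := fun i => by
    refine integrable_of_le_mul hw0 (hw1 i) (p := t - 1 / 2) (by ring) (abs_nonneg (2 * t))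
      ((((continuous_const.mul (smooth_coord i).continuous).mul
        (smooth_q_rpow _).continuous).mul hw.continuous).mul (hw.pd i).continuous) fun x => ?_
    rw [abs_mul, abs_mul, abs_mul, abs_mul, abs_of_pos (q_rpow_pos _ x)]
    have h1 : q x ^ (t - 1 / 2) = q x ^ (t - 1) * q x ^ (1 / 2 : ℝ) := by
      rw [← q_rpow_add]; congr 1; ring
    rw [h1]
    calc |2 * t| * |x i| * q x ^ (t - 1) * |w x| * |pd i w x|
        = (|2 * t| * q x ^ (t - 1) * |w x| * |pd i w x|) * |x i| := by ring
      _ ≤ (|2 * t| * q x ^ (t - 1) * |w x| * |pd i w x|) * q x ^ (1 / 2 : ℝ) := by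
        have := q_rpow_pos (t - 1) x
        exact mul_le_mul_of_nonneg_left (abs_coord_le x i) (by positivity)
      _ = _ := by ring
  have i3 : ∀ i, Integrable (fun x => q x ^ t * (w x * pd i (pd i w) x)) := fun i => by
    refine integrable_of_le_mul hw0 (hw2 i) (p := t) (by ring) zero_le_one
      ((smooth_q_rpow _).continuous.mul (hw.continuous.mul ((hw.pd i).pd i).continuous)) fun x => ?_
    rw [abs_mul, abs_mul, abs_of_pos (q_rpow_pos _ x), one_mul]
  have hint : Integrable (fun x => ∑ i, (2 * t * x i * q x ^ (t - 1) * w x * pd i w x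
      + q x ^ t * pd i w x ^ 2 + q x ^ t * (w x * pd i (pd i w) x))) :=
    integrable_finsetSum _ fun i _ => ((i2 i).add (hw1 i)).add (i3 i)
  refine ⟨hint, ?_⟩
  have := integral_div_eq_zero hs (fun i => by
    refine integrable_of_le_mul hw0 (hw1 i) (p := t - 1 / 2) (by ring) zero_le_one
      ((smooth_q_rpow _).continuous.mul (hs i).continuous) fun x => ?_
    rw [abs_mul, abs_mul, abs_mul, abs_of_pos (q_rpow_pos _ x),
      abs_of_pos (q_rpow_pos _ x), one_mul, ← mul_assoc, ← q_rpow_add]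
    exact le_of_eq (by congr 2; ring)) (by simpa only [hid] using hint)
  simpa only [hid] using this

/-- The squared Euclidean norm of the gradient. -/
noncomputable def gradSq (u : E3 → ℝ) (x : E3) : ℝ := ∑ i, pd i u x ^ 2

/-- The squared Frobenius norm of the Hessian. -/
noncomputable def hessSq (u : E3 → ℝ) (x : E3) : ℝ := ∑ i, ∑ j, pd i (pd j u) x ^ 2

lemma gradSq_nonneg (u : E3 → ℝ) (x : E3) : 0 ≤ gradSq u x :=
  Finset.sum_nonneg fun _ _ => sq_nonneg _

lemma hessSq_nonneg (u : E3 → ℝ) (x : E3) : 0 ≤ hessSq u x :=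
  Finset.sum_nonneg fun _ _ => Finset.sum_nonneg fun _ _ => sq_nonneg _

lemma integrable_gradSq {t : ℝ} {u : E3 → ℝ} (h : ∀ i, L2w t (pd i u)) :
    Integrable (fun x => q x ^ t * gradSq u x) := by
  simp_rw [gradSq, Finset.mul_sum]
  exact integrable_finsetSum _ fun i _ => h i

lemma integrable_hessSq {t : ℝ} {u : E3 → ℝ} (h : ∀ i j, L2w t (pd i (pd j u))) :
    Integrable (fun x => q x ^ t * hessSq u x) := by
  simp_rw [hessSq, Finset.mul_sum]
  exact integrable_finsetSum _ fun i _ => integrable_finsetSum _ fun j _ => h i j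

/-- Integrating a pointwise bound whose right side contains a term of vanishing integral. -/
lemma integral_le_of_null {F G R₁ R₂ : E3 → ℝ} {c₁ c₂ : ℝ} (hF : Integrable F) (hG : Integrable G)
    (hG0 : ∫ x, G x = 0) (h₁ : Integrable R₁) (h₂ : Integrable R₂)
    (h : ∀ x, F x ≤ G x + (c₁ * R₁ x + c₂ * R₂ x)) :
    ∫ x, F x ≤ c₁ * (∫ x, R₁ x) + c₂ * ∫ x, R₂ x := by
  have hI := integral_mono hF (hG.add ((h₁.const_mul c₁).add (h₂.const_mul c₂))) h
  rwa [integral_add' hG ((h₁.const_mul c₁).add (h₂.const_mul c₂)),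
    integral_add' (h₁.const_mul c₁) (h₂.const_mul c₂), integral_const_mul, integral_const_mul,
    hG0, zero_add] at hI

/-- Algebraic core of the weighted Hessian estimate. -/
lemma hessian_algebra {lam K ρ p m : ℝ} (hlam : 0 < lam) (hρ : 0 < ρ) (hm : m ^ 2 = ρ * p)
    {U a : Fin 3 → Fin 3 → ℝ} {V : Fin 3 → ℝ} {d : Fin 3 → Fin 3 → Fin 3 → ℝ}
    (hU : ∀ i j, U i j = U j i) (hd : ∀ l i j, |d l i j| ≤ K * m)
    (ha : ∀ ξ : Fin 3 → ℝ, lam * ∑ i, ξ i ^ 2 ≤ ∑ i, ∑ j, a i j * ξ i * ξ j) :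
    lam / 2 * (ρ * ∑ i, ∑ j, U i j ^ 2) ≤
      (∑ i, ∑ j, ∑ k, (ρ * a i j * (U k j * U i k - U i j * U k k)
        + (d i i j * U k j - d k i j * U i j) * V k))
      + (3 / lam * (ρ * (∑ i, ∑ j, a i j * U i j) ^ 2)
        + 108 * K ^ 2 / lam * (p * ∑ k, V k ^ 2)) := by
  have h1 : lam * ∑ i, ∑ j, U i j ^ 2 ≤ ∑ i, ∑ j, ∑ k, a i j * (U k j * U i k) := by
    have h := Finset.sum_le_sum fun k (_ : k ∈ Finset.univ) => ha fun i => U i k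
    refine le_trans (le_of_eq ?_) (h.trans (le_of_eq ?_))
    · simp only [Fin.sum_univ_three]; ring
    · simp only [Fin.sum_univ_three, hU 1 0, hU 2 0, hU 2 1]; ring
  have h2 : ∀ (D W v : ℝ), |D| ≤ K * m →
      -(D * W * v) ≤ lam / 24 * (ρ * W ^ 2) + 6 * K ^ 2 / lam * (p * v ^ 2) := by
    intro D W v hD
    have e1 : -(D * W * v) ≤ |D| * (|W| * |v|) := by
      rw [← abs_mul, ← abs_mul, ← mul_assoc]; exact neg_le_abs _
    have e2 : |D| * (|W| * |v|) ≤ K * m * (|W| * |v|) :=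
      mul_le_mul_of_nonneg_right hD (by positivity)
    have e3 : lam / 24 * (ρ * W ^ 2) + 6 * K ^ 2 / lam * (p * v ^ 2) - K * m * (|W| * |v|)
        = (lam * ρ * |W| - 12 * K * m * |v|) ^ 2 / (24 * lam * ρ) := by
      rw [sub_sq, mul_pow, mul_pow _ |v|, mul_pow _ m, hm, sq_abs, sq_abs]
      field_simp
      ring
    have e4 : 0 ≤ (lam * ρ * |W| - 12 * K * m * |v|) ^ 2 / (24 * lam * ρ) := by positivity
    linarith
  have h3 : ∑ i, ∑ j, ∑ k, -((d i i j * U k j - d k i j * U i j) * V k)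
      ≤ lam / 4 * (ρ * ∑ i, ∑ j, U i j ^ 2) + 108 * K ^ 2 / lam * (p * ∑ k, V k ^ 2) := by
    have h : ∀ i j k, -((d i i j * U k j - d k i j * U i j) * V k) ≤
        (lam / 24 * (ρ * U k j ^ 2) + 6 * K ^ 2 / lam * (p * V k ^ 2))
        + (lam / 24 * (ρ * U i j ^ 2) + 6 * K ^ 2 / lam * (p * V k ^ 2)) := by
      intro i j k
      have e1 := h2 (d i i j) (U k j) (V k) (hd _ _ _)
      have e2 := h2 (-d k i j) (U i j) (V k) (by rw [abs_neg]; exact hd _ _ _)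
      linarith
    refine (Finset.sum_le_sum fun i _ => Finset.sum_le_sum fun j _ => Finset.sum_le_sum
      fun k _ => h i j k).trans (le_of_eq ?_)
    simp only [Fin.sum_univ_three]; ring
  set g := ∑ i, ∑ j, a i j * U i j with hg
  set S := ∑ i, ∑ j, U i j ^ 2 with hS
  have h4 : g * (∑ k, U k k) ≤ lam / 4 * S + 3 / lam * g ^ 2 := by
    have e1 : (∑ k, U k k) ^ 2 ≤ 3 * S := by
      rw [hS]
      simp only [Fin.sum_univ_three]
      nlinarith [sq_nonneg (U 0 0 - U 1 1), sq_nonneg (U 0 0 - U 2 2), sq_nonneg (U 1 1 - U 2 2),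
        sq_nonneg (U 0 1), sq_nonneg (U 0 2), sq_nonneg (U 1 0), sq_nonneg (U 1 2),
        sq_nonneg (U 2 0), sq_nonneg (U 2 1)]
    have e2 : lam / 12 * (∑ k, U k k) ^ 2 + 3 / lam * g ^ 2 - g * (∑ k, U k k)
        = (lam * (∑ k, U k k) - 6 * g) ^ 2 / (12 * lam) := by
      field_simp; ring
    have e3 : 0 ≤ (lam * (∑ k, U k k) - 6 * g) ^ 2 / (12 * lam) := by positivity
    nlinarith
  have h5 : ∑ i, ∑ j, ∑ k, (ρ * a i j * (U k j * U i k - U i j * U k k)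
        + (d i i j * U k j - d k i j * U i j) * V k)
      = ρ * (∑ i, ∑ j, ∑ k, a i j * (U k j * U i k)) - ρ * (g * ∑ k, U k k)
        - ∑ i, ∑ j, ∑ k, -((d i i j * U k j - d k i j * U i j) * V k) := by
    rw [hg]
    simp only [Finset.mul_sum, Finset.sum_mul]
    rw [Finset.sum_comm' (s := Finset.univ) (t := fun _ => Finset.univ) (t' := Finset.univ)
      (s' := fun _ => Finset.univ) (by simp)]
    simp only [Fin.sum_univ_three]; ring
  rw [h5]
  have h6 := mul_le_mul_of_nonneg_left h1 hρ.le
  have h7 := mul_le_mul_of_nonneg_left h4 hρ.le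
  have e1 : ρ * (lam * S) = lam * (ρ * S) := by ring
  have e2 : ρ * (lam / 4 * S + 3 / lam * g ^ 2) = lam / 4 * (ρ * S) + 3 / lam * (ρ * g ^ 2) := by
    ring
  rw [e1] at h6
  rw [e2] at h7
  linarith

lemma q_rpow_mul_abs_pd_le {t K : ℝ} {f : E3 → ℝ} (hf : Smooth f)
    (h0 : ∀ x, |f x| ≤ K) (h1 : ∀ l x, |pd l f x| ≤ K * q x ^ (-(1 / 2) : ℝ)) (l : Fin 3) (x : E3) :
    |pd l (fun x => q x ^ t * f x) x| ≤ ((2 * |t| + 1) * K) * q x ^ (t - 1 / 2) := by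
  rw [pd_mul (smooth_q_rpow t) hf, pd_q_rpow]
  have e1 : q x ^ (t - 1 / 2) = q x ^ (1 / 2 : ℝ) * q x ^ (t - 1) := by
    rw [← q_rpow_add]; congr 1; ring
  have e2 : q x ^ (t - 1 / 2) = q x ^ t * q x ^ (-(1 / 2) : ℝ) := by
    rw [← q_rpow_add]; congr 1
  have p1 := q_rpow_pos (t - 1) x
  have p2 := q_rpow_pos t x
  have p3 := q_rpow_pos (1 / 2) x
  have b1 : |2 * t * x l * q x ^ (t - 1) * f x| ≤ 2 * |t| * K * q x ^ (t - 1 / 2) := by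
    rw [abs_mul, abs_mul, abs_mul, abs_mul, abs_of_pos p1, e1, abs_two]
    calc 2 * |t| * |x l| * q x ^ (t - 1) * |f x| = (2 * |t| * q x ^ (t - 1)) * (|x l| * |f x|) := by
          ring
      _ ≤ (2 * |t| * q x ^ (t - 1)) * (q x ^ (1 / 2 : ℝ) * K) := by
          refine mul_le_mul_of_nonneg_left ?_ (by positivity)
          exact mul_le_mul (abs_coord_le x l) (h0 x) (abs_nonneg _) p3.le
      _ = _ := by ring
  have b2 : |q x ^ t * pd l f x| ≤ K * q x ^ (t - 1 / 2) := by
    rw [abs_mul, abs_of_pos p2, e2]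
    have := mul_le_mul_of_nonneg_left (h1 l x) p2.le
    linarith
  calc _ ≤ _ := abs_add_le _ _
    _ ≤ _ := add_le_add b1 b2
    _ = _ := by ring

/-- Weighted Hessian bound for `a^{ij}∂ᵢ∂ⱼ` in terms of the gradient. -/
lemma hessian_estimate {lam K : ℝ} (t : ℝ) (hlam : 0 < lam) (hK : 0 ≤ K) :
    ∃ C : ℝ, 0 ≤ C ∧ ∀ (a : Fin 3 → Fin 3 → E3 → ℝ),
      (∀ i j, Smooth (a i j)) → (∀ i j x, |a i j x| ≤ K) →
      (∀ i j l x, |pd l (a i j) x| ≤ K * q x ^ (-(1 / 2) : ℝ)) →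
      (∀ x (ξ : Fin 3 → ℝ), lam * ∑ i, ξ i ^ 2 ≤ ∑ i, ∑ j, a i j x * ξ i * ξ j) →
      ∀ u, Smooth u → (∀ i, L2w (t - 1) (pd i u)) → (∀ i j, L2w t (pd i (pd j u))) →
      L2w t (fun x => ∑ i, ∑ j, a i j x * pd i (pd j u) x) →
      ∫ x, q x ^ t * hessSq u x ≤
        C * ((∫ x, q x ^ t * (∑ i, ∑ j, a i j x * pd i (pd j u) x) ^ 2)
          + ∫ x, q x ^ (t - 1) * gradSq u x) := by
  set K' := (2 * |t| + 1) * K with hK'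
  have hK'0 : 0 ≤ K' := by positivity
  set C0 := 3 / lam + 108 * K' ^ 2 / lam
  refine ⟨2 / lam * C0, by positivity, fun a hs h0 h1 hell u hu hu1 hu2 hg => ?_⟩
  have hb : ∀ i j, Smooth (fun x => q x ^ t * a i j x) := fun i j => (smooth_q_rpow t).mul (hs i j)
  have hN := fun i j k => integral_null_form (t := t) (hb i j) (hu.pd j) (hu.pd k) hK'0 i k
    (fun x => by
      rw [abs_mul, abs_of_pos (q_rpow_pos t x), mul_comm]
      refine mul_le_mul_of_nonneg_right ((h0 i j x).trans ?_) (q_rpow_pos t x).le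
      rw [hK']
      nlinarith [abs_nonneg t])
    (fun l x => q_rpow_mul_abs_pd_le (hs i j) (h0 i j) (h1 i j) l x)
    (fun l => hu2 l j) (fun l => hu2 l k) (hu1 k)
  have hpt : ∀ x, lam / 2 * (q x ^ t * hessSq u x) ≤ _ + _ := fun x =>
    hessian_algebra (K := K') (ρ := q x ^ t) (p := q x ^ (t - 1)) (m := q x ^ (t - 1 / 2))
      (U := fun i j => pd i (pd j u) x) (a := fun i j => a i j x) (V := fun k => pd k u x)
      (d := fun l i j => pd l (fun x => q x ^ t * a i j x) x) hlam (q_rpow_pos t x)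
      (by rw [sq, ← q_rpow_add, ← q_rpow_add]; congr 1; ring)
      (fun i j => pd_comm hu i j x)
      (fun l i j => q_rpow_mul_abs_pd_le (hs i j) (h0 i j) (h1 i j) l x)
      (hell x)
  have hNi := integrable_finsetSum Finset.univ fun i _ => integrable_finsetSum Finset.univ
    fun j _ => integrable_finsetSum Finset.univ fun k _ => (hN i j k).1
  have hN0 : ∫ x, ∑ i : Fin 3, ∑ j : Fin 3, ∑ k : Fin 3,
      (q x ^ t * a i j x * (pd k (pd j u) x * pd i (pd k u) x - pd i (pd j u) x * pd k (pd k u) x)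
      + (pd i (fun x => q x ^ t * a i j x) x * pd k (pd j u) x
        - pd k (fun x => q x ^ t * a i j x) x * pd i (pd j u) x) * pd k u x) = 0 := by
    rw [integral_finsetSum _ fun i _ => integrable_finsetSum _ fun j _ =>
      integrable_finsetSum _ fun k _ => (hN i j k).1]
    refine Finset.sum_eq_zero fun i _ => ?_
    rw [integral_finsetSum _ fun j _ => integrable_finsetSum _ fun k _ => (hN i j k).1]
    refine Finset.sum_eq_zero fun j _ => ?_
    rw [integral_finsetSum _ fun k _ => (hN i j k).1]
    exact Finset.sum_eq_zero fun k _ => (hN i j k).2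
  have hI := integral_le_of_null ((integrable_hessSq hu2).const_mul (lam / 2)) hNi hN0 hg
    (integrable_gradSq hu1) hpt
  rw [integral_const_mul] at hI
  set G := ∫ x, q x ^ t * (∑ i, ∑ j, a i j x * pd i (pd j u) x) ^ 2
  set D := ∫ x, q x ^ (t - 1) * gradSq u x
  have hG : 0 ≤ G := integral_nonneg fun x => by have := q_rpow_pos t x; positivity
  have hD : 0 ≤ D := integral_nonneg fun x =>
    mul_nonneg (q_rpow_pos _ x).le (gradSq_nonneg u x)
  have hc : 3 / lam * G + 108 * K' ^ 2 / lam * D ≤ C0 * (G + D) := by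
    have e1 : 0 ≤ 3 / lam * D := by positivity
    have e2 : 0 ≤ 108 * K' ^ 2 / lam * G := by positivity
    have : C0 * (G + D) = 3 / lam * G + 108 * K' ^ 2 / lam * D
      + (3 / lam * D + 108 * K' ^ 2 / lam * G) := by ring
    linarith
  have := hI.trans hc
  calc ∫ x, q x ^ t * hessSq u x = 2 / lam * (lam / 2 * ∫ x, q x ^ t * hessSq u x) := by
        field_simp
    _ ≤ 2 / lam * (C0 * (G + D)) := mul_le_mul_of_nonneg_left this (by positivity)
    _ = _ := by ring

/-- Weighted interpolation of the gradient between the function and its Hessian. -/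
lemma gradient_interpolation (t : ℝ) {η : ℝ} (hη : 0 < η) :
    ∃ C : ℝ, 0 ≤ C ∧ ∀ u, Smooth u → L2w (t - 1) u → (∀ i, L2w t (pd i u)) →
      (∀ i j, L2w (t + 1) (pd i (pd j u))) →
      ∫ x, q x ^ t * gradSq u x ≤
        η * (∫ x, q x ^ (t + 1) * hessSq u x) + C * ∫ x, q x ^ (t - 1) * u x ^ 2 := by
  set c := 6 * (2 * t ^ 2 + 1 / (2 * η)) with hc
  refine ⟨c, by positivity, fun u hu h0 h1 h2 => ?_⟩
  obtain ⟨hi, hz⟩ := integral_energy hu h0 h1 (fun l => h2 l l)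
  have hpt : ∀ x, q x ^ t * gradSq u x ≤
      2 * ∑ i, (2 * t * x i * q x ^ (t - 1) * u x * pd i u x
        + q x ^ t * pd i u x ^ 2 + q x ^ t * (u x * pd i (pd i u) x))
      + (η * (q x ^ (t + 1) * hessSq u x) + c * (q x ^ (t - 1) * u x ^ 2)) := by
    intro x
    have p0 := q_rpow_pos (t - 1) x
    have p1 := q_rpow_pos t x
    have p2 := q_rpow_pos (t + 1) x
    have b1 : ∀ i, -(2 * t * x i * q x ^ (t - 1) * u x * pd i u x) ≤
        1 / 2 * (q x ^ t * pd i u x ^ 2) + 2 * t ^ 2 * (q x ^ (t - 1) * u x ^ 2) := by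
      intro i
      have e0 : x i ^ 2 * q x ^ (t - 1) ≤ q x ^ t := by
        have e : q x ^ t = q x * q x ^ (t - 1) := by
          conv_rhs => rw [← Real.rpow_one (q x), ← Real.rpow_mul (q_pos x).le, one_mul,
            ← q_rpow_add]
          congr 1; ring
        rw [e]
        refine mul_le_mul_of_nonneg_right ?_ p0.le
        have := Finset.single_le_sum (f := fun i => x i ^ 2) (fun j _ => sq_nonneg (x j))
          (Finset.mem_univ i)
        simp only at this
        rw [q_eq_sum]; linarith
      have e1 : 0 ≤ q x ^ (t - 1) * (x i * pd i u x + 2 * t * u x) ^ 2 := by positivity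
      nlinarith [mul_le_mul_of_nonneg_right e0 (sq_nonneg (pd i u x))]
    have b2 : ∀ i, -(q x ^ t * (u x * pd i (pd i u) x)) ≤
        η / 2 * (q x ^ (t + 1) * pd i (pd i u) x ^ 2) + 1 / (2 * η) * (q x ^ (t - 1) * u x ^ 2) := by
      intro i
      have := weighted_amgm (s := t + 1) (t := t - 1) (p := t) (η := η / 2) (by positivity) (by ring)
        x (pd i (pd i u) x) (u x)
      have e : -(q x ^ t * (u x * pd i (pd i u) x)) ≤
          q x ^ t * (|pd i (pd i u) x| * |u x|) := by
        rw [← abs_mul, ← mul_neg]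
        refine mul_le_mul_of_nonneg_left ?_ p1.le
        rw [mul_comm]; exact neg_le_abs _
      have e4 : 1 / (4 * (η / 2)) = 1 / (2 * η) := by congr 1; ring
      rw [e4] at this
      linarith
    have b3 : ∑ i, pd i (pd i u) x ^ 2 ≤ hessSq u x :=
      Finset.sum_le_sum fun i _ => Finset.single_le_sum (f := fun j => pd i (pd j u) x ^ 2)
        (fun j _ => sq_nonneg _) (Finset.mem_univ i)
    have b4 := Finset.sum_le_sum fun i (_ : i ∈ Finset.univ) => add_le_add (b1 i) (b2 i)
    have b5 : q x ^ (t + 1) * ∑ i, pd i (pd i u) x ^ 2 ≤ q x ^ (t + 1) * hessSq u x :=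
      mul_le_mul_of_nonneg_left b3 p2.le
    unfold gradSq
    rw [hc]
    have b6 := mul_le_mul_of_nonneg_left b5 hη.le
    simp only [Fin.sum_univ_three] at b4 b6 ⊢
    nlinarith
  exact integral_le_of_null (integrable_gradSq h1) (hi.const_mul 2)
    (by rw [integral_const_mul, hz, mul_zero]) (integrable_hessSq h2) h0 hpt

lemma L2w.of_le {s t r K : ℝ} {f h : E3 → ℝ} (hf : L2w t f) (hh : Continuous h)
    (hb : ∀ x, |h x| ≤ K * q x ^ r * |f x|) (hr : s + 2 * r ≤ t) : L2w s h := by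
  have hq : Continuous fun x => q x ^ s := (smooth_q_rpow s).continuous
  refine (hf.const_mul (K ^ 2)).mono' (hq.mul (hh.pow 2)).aestronglyMeasurable
    (Filter.Eventually.of_forall fun x => ?_)
  have p := q_rpow_pos s x
  rw [Real.norm_of_nonneg (by positivity)]
  have e1 : h x ^ 2 ≤ (K * q x ^ r * |f x|) ^ 2 := by
    rw [← sq_abs]; exact pow_le_pow_left₀ (abs_nonneg _) (hb x) 2
  have e2 : q x ^ s * (q x ^ r) ^ 2 ≤ q x ^ t := by
    rw [sq, ← q_rpow_add, ← q_rpow_add]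
    exact q_rpow_mono (by linarith) x
  calc q x ^ s * h x ^ 2 ≤ q x ^ s * (K * q x ^ r * |f x|) ^ 2 :=
        mul_le_mul_of_nonneg_left e1 p.le
    _ = q x ^ s * (q x ^ r) ^ 2 * (K ^ 2 * f x ^ 2) := by rw [mul_pow, mul_pow, sq_abs]; ring
    _ ≤ q x ^ t * (K ^ 2 * f x ^ 2) := mul_le_mul_of_nonneg_right e2 (by positivity)
    _ = _ := by ring

lemma L2w.mono {s t : ℝ} {f : E3 → ℝ} (hf : L2w t f) (hc : Continuous f) (h : s ≤ t) : L2w s f :=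
  hf.of_le (r := 0) (K := 1) hc (fun x => by simp) (by linarith)

lemma L2w.add {t : ℝ} {f g : E3 → ℝ} (hf : L2w t f) (hg : L2w t g) (hfc : Continuous f)
    (hgc : Continuous g) : L2w t (fun x => f x + g x) := by
  have hq : Continuous fun x => q x ^ t := (smooth_q_rpow t).continuous
  refine ((Integrable.add hf hg).const_mul 2).mono'
    (hq.mul ((hfc.add hgc).pow 2)).aestronglyMeasurable (Filter.Eventually.of_forall fun x => ?_)
  have p := q_rpow_pos t x
  rw [Real.norm_of_nonneg (by positivity)]
  simp only [Pi.add_apply]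
  nlinarith [mul_nonneg p.le (sq_nonneg (f x - g x))]

lemma L2w.sum {t : ℝ} {ι : Type*} (s : Finset ι) {f : ι → E3 → ℝ} (hf : ∀ i ∈ s, L2w t (f i))
    (hc : ∀ i ∈ s, Continuous (f i)) : L2w t (fun x => ∑ i ∈ s, f i x) := by
  classical
  induction s using Finset.induction_on with
  | empty => simp [L2w]
  | insert a s ha ih =>
    simp_rw [Finset.sum_insert ha]
    exact (hf a (by simp)).add (ih (fun i hi => hf i (by simp [hi])) fun i hi => hc i (by simp [hi]))
      (hc a (by simp)) (continuous_finsetSum _ fun i hi => hc i (by simp [hi]))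

/-- The second order operator with coefficients `a`, `b`, `c`. -/
noncomputable def diffOp (a : Fin 3 → Fin 3 → E3 → ℝ) (b : Fin 3 → E3 → ℝ) (c u : E3 → ℝ) :
    E3 → ℝ :=
  fun x => (∑ i, ∑ j, a i j x * pd i (pd j u) x) + (∑ i, b i x * pd i u x) + c x * u x

/-- Ellipticity together with pointwise decay of the coefficients towards the Laplacian. -/
structure DecayBound (ε lam K : ℝ) (a : Fin 3 → Fin 3 → E3 → ℝ) (b : Fin 3 → E3 → ℝ)
    (c : E3 → ℝ) : Prop where
  smooth_a : ∀ i j, Smooth (a i j)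
  smooth_b : ∀ i, Smooth (b i)
  smooth_c : Smooth c
  elliptic : ∀ x (ξ : Fin 3 → ℝ), lam * ∑ i, ξ i ^ 2 ≤ ∑ i, ∑ j, a i j x * ξ i * ξ j
  bound_a : ∀ i j x, |a i j x - if i = j then 1 else 0| ≤ K * q x ^ (-ε)
  bound_da : ∀ i j l x, |pd l (a i j) x| ≤ K * q x ^ (-(1 / 2) : ℝ)
  bound_b : ∀ i x, |b i x| ≤ K * q x ^ (-(1 / 2) - ε)
  bound_c : ∀ x, |c x| ≤ K * q x ^ (-1 - ε)

/-- Finiteness of the weighted second order Sobolev norm. -/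
structure H2w (τ : ℝ) (u : E3 → ℝ) : Prop where
  zero : L2w τ u
  one : ∀ i, L2w (τ + 1) (pd i u)
  two : ∀ i j, L2w (τ + 2) (pd i (pd j u))

lemma H2w.mono {s t : ℝ} {u : E3 → ℝ} (h : H2w t u) (hu : Smooth u) (hst : s ≤ t) : H2w s u :=
  ⟨h.zero.mono hu.continuous hst, fun i => (h.one i).mono (hu.pd i).continuous (by linarith),
    fun i j => (h.two i j).mono ((hu.pd j).pd i).continuous (by linarith)⟩

section

variable {ε lam K τ : ℝ} {a : Fin 3 → Fin 3 → E3 → ℝ} {b : Fin 3 → E3 → ℝ} {c u : E3 → ℝ}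

lemma smooth_diffOp (ha : ∀ i j, Smooth (a i j)) (hb : ∀ i, Smooth (b i)) (hc : Smooth c)
    (hu : Smooth u) : Smooth (diffOp a b c u) :=
  ((Smooth.sum fun i _ => Smooth.sum fun j _ => (ha i j).mul ((hu.pd j).pd i)).add
    (Smooth.sum fun i _ => (hb i).mul (hu.pd i))).add (hc.mul hu)

lemma DecayBound.K_nonneg (h : DecayBound ε lam K a b c) : 0 ≤ K := by
  have h1 := (abs_nonneg _).trans (h.bound_c 0)
  exact nonneg_of_mul_nonneg_left h1 (q_rpow_pos _ _)

lemma DecayBound.abs_a_le (h : DecayBound ε lam K a b c) (hε : 0 ≤ ε) (i j : Fin 3) (x : E3) :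
    |a i j x| ≤ K + 1 := by
  have h1 := h.bound_a i j x
  have h2 : q x ^ (-ε) ≤ 1 := Real.rpow_le_one_of_one_le_of_nonpos (one_le_q x) (by linarith)
  have h3 := mul_le_mul_of_nonneg_left h2 h.K_nonneg
  have h4 : |(if i = j then (1 : ℝ) else 0)| ≤ 1 := by split_ifs <;> simp
  have h5 := abs_add_le (a i j x - if i = j then 1 else 0) (if i = j then 1 else 0)
  rw [sub_add_cancel] at h5
  linarith

lemma DecayBound.l2w_principal (h : DecayBound ε lam K a b c) (hε : 0 ≤ ε) (hu : Smooth u)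
    (hH : H2w τ u) : L2w (τ + 2) (fun x => ∑ i, ∑ j, a i j x * pd i (pd j u) x) := by
  have hc : ∀ i j, Continuous fun x => a i j x * pd i (pd j u) x := fun i j =>
    (h.smooth_a i j).continuous.mul ((hu.pd j).pd i).continuous
  refine L2w.sum _ (fun i _ => L2w.sum _ (fun j _ => ?_) fun j _ => hc i j)
    fun i _ => continuous_finsetSum _ fun j _ => hc i j
  refine (hH.two i j).of_le (r := 0) (K := K + 1) (hc i j) (fun x => ?_) (by linarith)
  rw [abs_mul, Real.rpow_zero, mul_one]
  exact mul_le_mul_of_nonneg_right (h.abs_a_le hε i j x) (abs_nonneg _)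

lemma DecayBound.l2w_diffOp (h : DecayBound ε lam K a b c) (hε : 0 ≤ ε) (hu : Smooth u)
    (hH : H2w τ u) : L2w (τ + 2) (diffOp a b c u) := by
  have hca : Continuous (fun x => ∑ i, ∑ j, a i j x * pd i (pd j u) x) :=
    continuous_finsetSum _ fun i _ => continuous_finsetSum _ fun j _ =>
      (h.smooth_a i j).continuous.mul ((hu.pd j).pd i).continuous
  have hcb : ∀ i, Continuous (fun x => b i x * pd i u x) := fun i =>
    (h.smooth_b i).continuous.mul (hu.pd i).continuous
  have hcc : Continuous (fun x => c x * u x) := h.smooth_c.continuous.mul hu.continuous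
  have hcb' := continuous_finsetSum Finset.univ fun i _ => hcb i
  refine ((h.l2w_principal hε hu hH).add (L2w.sum _ (fun i _ => ?_) fun i _ => hcb i) hca
    hcb').add ?_ (hca.add hcb') hcc
  · refine (hH.one i).of_le (K := K) (hcb i) (fun x => ?_) (by linarith : τ + 2 + 2 * (-(1 / 2) - ε) ≤ τ + 1)
    rw [abs_mul]
    exact mul_le_mul_of_nonneg_right (h.bound_b i x) (abs_nonneg _)
  · refine hH.zero.of_le (K := K) hcc (fun x => ?_) (by linarith : τ + 2 + 2 * (-1 - ε) ≤ τ)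
    rw [abs_mul]
    exact mul_le_mul_of_nonneg_right (h.bound_c x) (abs_nonneg _)

/-- Pointwise bound for the lower order terms. -/
lemma DecayBound.lower_order_le (h : DecayBound ε lam K a b c) (x : E3) :
    q x ^ (τ + 2) * ((∑ i, b i x * pd i u x) ^ 2 + (c x * u x) ^ 2) ≤
      3 * K ^ 2 * (q x ^ (τ + 1 - 2 * ε) * gradSq u x)
        + K ^ 2 * (q x ^ (τ - 2 * ε) * u x ^ 2) := by
  have p := q_rpow_pos (τ + 2) x
  have h1 : (∑ i, b i x * pd i u x) ^ 2 ≤ 3 * (K * q x ^ (-(1 / 2) - ε)) ^ 2 * gradSq u x := by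
    refine (Finset.sum_mul_sq_le_sq_mul_sq _ _ _).trans ?_
    refine mul_le_mul_of_nonneg_right ?_ (gradSq_nonneg u x)
    have : ∀ i ∈ Finset.univ, b i x ^ 2 ≤ (K * q x ^ (-(1 / 2) - ε)) ^ 2 := fun i _ => by
      rw [← sq_abs]; exact pow_le_pow_left₀ (abs_nonneg _) (h.bound_b i x) 2
    refine (Finset.sum_le_sum this).trans (le_of_eq ?_)
    simp
  have h2 : (c x * u x) ^ 2 ≤ (K * q x ^ (-1 - ε)) ^ 2 * u x ^ 2 := by
    rw [mul_pow]
    refine mul_le_mul_of_nonneg_right ?_ (sq_nonneg _)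
    rw [← sq_abs]; exact pow_le_pow_left₀ (abs_nonneg _) (h.bound_c x) 2
  have e1 : q x ^ (τ + 1 - 2 * ε) = q x ^ (τ + 2) * (q x ^ (-(1 / 2) - ε)) ^ 2 := by
    rw [sq, ← q_rpow_add, ← q_rpow_add]; congr 1; ring
  have e2 : q x ^ (τ - 2 * ε) = q x ^ (τ + 2) * (q x ^ (-1 - ε)) ^ 2 := by
    rw [sq, ← q_rpow_add, ← q_rpow_add]; congr 1; ring
  rw [e1, e2]
  have := mul_le_mul_of_nonneg_left (add_le_add h1 h2) p.le
  refine this.trans (le_of_eq ?_)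
  ring

end

lemma integral_le_of_le_add₃ {F R₁ R₂ R₃ : E3 → ℝ} {c₁ c₂ c₃ : ℝ} (hF : Integrable F)
    (h₁ : Integrable R₁) (h₂ : Integrable R₂) (h₃ : Integrable R₃)
    (h : ∀ x, F x ≤ c₁ * R₁ x + (c₂ * R₂ x + c₃ * R₃ x)) :
    ∫ x, F x ≤ c₁ * (∫ x, R₁ x) + (c₂ * (∫ x, R₂ x) + c₃ * ∫ x, R₃ x) := by
  have hI := integral_mono hF ((h₁.const_mul c₁).add ((h₂.const_mul c₂).add (h₃.const_mul c₃))) h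
  rwa [integral_add' (h₁.const_mul c₁) ((h₂.const_mul c₂).add (h₃.const_mul c₃)),
    integral_add' (h₂.const_mul c₂) (h₃.const_mul c₃), integral_const_mul, integral_const_mul,
    integral_const_mul] at hI

/-- Weighted elliptic regularity of second order, for functions with finite norm. -/
lemma second_order_regularity {ε lam K : ℝ} (τ : ℝ) (hε : 0 ≤ ε) (hlam : 0 < lam) (hK : 0 ≤ K) :
    ∃ C : ℝ, 0 ≤ C ∧ ∀ a b c, DecayBound ε lam K a b c → ∀ u, Smooth u → H2w τ u →
      (∫ x, q x ^ (τ + 1) * gradSq u x) + (∫ x, q x ^ (τ + 2) * hessSq u x) ≤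
        C * ((∫ x, q x ^ (τ + 2) * diffOp a b c u x ^ 2) + ∫ x, q x ^ τ * u x ^ 2) := by
  obtain ⟨C1, hC1, h1⟩ := hessian_estimate (lam := lam) (K := K + 1) (τ + 2) hlam (by linarith)
  set B := C1 * (9 * K ^ 2 + 1) with hB
  have hB0 : 0 ≤ B := by positivity
  obtain ⟨C2, hC2, h2⟩ := gradient_interpolation (τ + 1) (η := 1 / (2 * (B + 1))) (by positivity)
  refine ⟨4 * (B * C2 + C1 * (3 + 3 * K ^ 2)) + C2, by positivity,
    fun a b c hD u hu hH => ?_⟩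
  have hLi : Integrable (fun x => q x ^ (τ + 2) * diffOp a b c u x ^ 2) := hD.l2w_diffOp hε hu hH
  have hPi := hD.l2w_principal hε hu hH
  have hGi := integrable_gradSq hH.one
  have hUi : Integrable (fun x => q x ^ τ * u x ^ 2) := hH.zero
  have k1 := h1 a hD.smooth_a (hD.abs_a_le hε) (fun i j l x => (hD.bound_da i j l x).trans
    (mul_le_mul_of_nonneg_right (by linarith) (q_rpow_pos _ x).le)) hD.elliptic u hu
    (fun i => by convert hH.one i using 1; ring) hH.two hPi
  have k2 := h2 u hu (by convert hH.zero using 1; ring) hH.one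
    (fun i j => by convert hH.two i j using 1; ring)
  have e1 : τ + 2 - 1 = τ + 1 := by ring
  have e2 : τ + 1 + 1 = τ + 2 := by ring
  have e3 : τ + 1 - 1 = τ := by ring
  rw [e1] at k1
  rw [e2, e3] at k2
  have k3 : ∫ x, q x ^ (τ + 2) * (∑ i, ∑ j, a i j x * pd i (pd j u) x) ^ 2 ≤
      3 * (∫ x, q x ^ (τ + 2) * diffOp a b c u x ^ 2)
      + (9 * K ^ 2 * (∫ x, q x ^ (τ + 1) * gradSq u x) + 3 * K ^ 2 * ∫ x, q x ^ τ * u x ^ 2) := by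
    refine integral_le_of_le_add₃ hPi hLi hGi hUi fun x => ?_
    have l1 := hD.lower_order_le (u := u) (τ := τ) x
    have l2 := mul_le_mul_of_nonneg_right (q_rpow_mono (by linarith : τ + 1 - 2 * ε ≤ τ + 1) x)
      (gradSq_nonneg u x)
    have l3 := mul_le_mul_of_nonneg_right (q_rpow_mono (by linarith : τ - 2 * ε ≤ τ) x)
      (sq_nonneg (u x))
    have l2' := mul_le_mul_of_nonneg_left l2 (by positivity : 0 ≤ 3 * K ^ 2)
    have l3' := mul_le_mul_of_nonneg_left l3 (by positivity : 0 ≤ K ^ 2)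
    have p := q_rpow_pos (τ + 2) x
    have l4 : (∑ i, ∑ j, a i j x * pd i (pd j u) x) ^ 2 ≤ 3 * diffOp a b c u x ^ 2
        + 3 * ((∑ i, b i x * pd i u x) ^ 2 + (c x * u x) ^ 2) := by
      unfold diffOp
      generalize (∑ i, ∑ j, a i j x * pd i (pd j u) x) = P
      generalize (∑ i, b i x * pd i u x) = S
      generalize c x * u x = R
      nlinarith [sq_nonneg (P + S + R + S), sq_nonneg (P + S + R + R), sq_nonneg (S - R)]
    have l5 := mul_le_mul_of_nonneg_left l4 p.le
    nlinarith
  set H := ∫ x, q x ^ (τ + 2) * hessSq u x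
  set G := ∫ x, q x ^ (τ + 1) * gradSq u x
  set U := ∫ x, q x ^ τ * u x ^ 2
  set F := ∫ x, q x ^ (τ + 2) * diffOp a b c u x ^ 2
  have hH0 : 0 ≤ H := integral_nonneg fun x =>
    mul_nonneg (q_rpow_pos _ x).le (hessSq_nonneg u x)
  have hU0 : 0 ≤ U := integral_nonneg fun x => mul_nonneg (q_rpow_pos _ x).le (sq_nonneg _)
  have hF0 : 0 ≤ F := integral_nonneg fun x => mul_nonneg (q_rpow_pos _ x).le (sq_nonneg _)
  have m1 : H ≤ B * G + C1 * (3 * F + 3 * K ^ 2 * U) := by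
    have := mul_le_mul_of_nonneg_left k3 hC1
    rw [hB]; linarith
  have m2 : B * (1 / (2 * (B + 1)) * H) ≤ H / 2 := by
    have : H / 2 - B * (1 / (2 * (B + 1)) * H) = H / (2 * (B + 1)) := by field_simp; ring
    have : 0 ≤ H / (2 * (B + 1)) := by positivity
    linarith
  have m3 : 1 / (2 * (B + 1)) * H ≤ H := by
    have : 1 / (2 * (B + 1)) ≤ 1 := by
      rw [div_le_one (by positivity)]; linarith
    exact mul_le_of_le_one_left hH0 this
  have m4 := mul_le_mul_of_nonneg_left k2 hB0
  have m5 : 0 ≤ B * C2 * F := by positivity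
  have m6 : 0 ≤ C1 * U := by positivity
  have m7 : 0 ≤ C2 * F := by positivity
  have m8 : 0 ≤ C1 * K ^ 2 * F := by positivity
  nlinarith

/-- The Laplacian. -/
noncomputable def lap (u : E3 → ℝ) (x : E3) : ℝ := ∑ i, pd i (pd i u) x

lemma q_rpow_sub_one (t : ℝ) (x : E3) : q x ^ t = q x * q x ^ (t - 1) := by
  rw [Real.rpow_sub_one (q_pos x).ne']
  field_simp [(q_pos x).ne']

lemma q_rpow_sub_two (t : ℝ) (x : E3) : q x ^ (t - 1) = q x * q x ^ (t - 2) := by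
  rw [q_rpow_sub_one]; congr 2; ring

/-- Pointwise algebra behind Hardy's inequality, `G` being a null term. -/
lemma hardy_algebra {t κ p Q w : ℝ} {x V : Fin 3 → ℝ} (hp : 0 < p) (hQ : Q = 1 + ∑ i, x i ^ 2)
    (hκ : 2 * κ = 2 * t + 1) :
    κ ^ 2 * (Q * p * w ^ 2) ≤
      κ * ((2 * t + 1) * (Q * p * w ^ 2) - (2 * t - 2) * (p * w ^ 2)
        + 2 * (Q * p * (w * ∑ i, x i * V i)))
      + (1 * (Q * (Q * p) * ∑ i, V i ^ 2) + κ * (2 * t - 2 - κ) * (p * w ^ 2)) := by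
  have h : 0 ≤ p * ∑ i, (Q * V i + κ * x i * w) ^ 2 := by positivity
  have e : p * ∑ i, (Q * V i + κ * x i * w) ^ 2 = Q * (Q * p) * ∑ i, V i ^ 2
      + 2 * κ * (Q * p * (w * ∑ i, x i * V i)) + κ ^ 2 * (p * w ^ 2) * (Q - 1) := by
    rw [hQ]; simp only [Fin.sum_univ_three]; ring
  rw [e] at h
  rw [← hκ]
  have ht : t = κ - 1 / 2 := by linarith
  nlinarith

/-- Hardy's inequality with weights, up to a lower order term. -/
lemma hardy {t κ : ℝ} (hκ : 2 * κ = 2 * t + 1) {w : E3 → ℝ} (hw : Smooth w)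
    (hw0 : L2w (t - 1) w) (hw1 : ∀ l, L2w t (pd l w)) :
    κ ^ 2 * (∫ x, q x ^ (t - 1) * w x ^ 2) ≤ (∫ x, q x ^ t * gradSq w x)
      + κ * (2 * t - 2 - κ) * ∫ x, q x ^ (t - 2) * w x ^ 2 := by
  obtain ⟨hi, hz⟩ := integral_radial hw hw0 hw1
  have := integral_le_of_null (c₁ := 1) (c₂ := κ * (2 * t - 2 - κ)) (Integrable.const_mul hw0 (κ ^ 2))
    (hi.const_mul κ) (by rw [integral_const_mul, hz, mul_zero]) (integrable_gradSq hw1)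
    (hw0.mono hw.continuous (by linarith : t - 2 ≤ t - 1)) (fun x => by
      rw [q_rpow_sub_one t, q_rpow_sub_two]
      exact hardy_algebra (q_rpow_pos _ x) (q_eq_sum x) hκ)
  rwa [integral_const_mul, one_mul] at this

/-- Pointwise algebra behind the weighted estimate for the Laplacian. -/
lemma laplacian_algebra {c p Q θ : ℝ} {x V : Fin 3 → ℝ} {U : Fin 3 → Fin 3 → ℝ} (hp : 0 < p)
    (hQ : Q = 1 + ∑ i, x i ^ 2) (hU : ∀ i j, U i j = U j i) (hθ : 0 < θ)
    (hc : 8 * θ = 1 - 4 * c ^ 2) :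
    θ * (Q * p * ∑ k, V k ^ 2) ≤
      ((∑ i, ∑ k, (Q * (Q * p) * (U k i * U i k - U i i * U k k)
        + (2 * c * x i * (Q * p) * U k i - 2 * c * x k * (Q * p) * U i i) * V k))
      + 1 / 2 * ∑ k, ((2 * c + 1) * (Q * p * V k ^ 2) - (2 * c - 2) * (p * V k ^ 2)
        + 2 * (Q * p * (V k * ∑ i, x i * U i k))))
      + ((1 + c ^ 2 / θ) * (Q * (Q * p) * (∑ i, U i i) ^ 2)
        + (|(c + 1 / 2) * (2 * c - 2 - (c + 1 / 2))| + |c * (2 * c - 2)|)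
          * (p * ∑ k, V k ^ 2)) := by
  have h1 := Finset.sum_le_sum fun k (_ : k ∈ (Finset.univ : Finset (Fin 3))) =>
    hardy_algebra (t := c) (κ := c + 1 / 2) (w := V k) (V := fun i => U i k) hp hQ (by ring)
  have h2 : 2 * c * ((∑ i, U i i) * ∑ k, x k * V k) * (Q * p) ≤
      θ * (Q * p * ∑ k, V k ^ 2) + c ^ 2 / θ * (Q * (Q * p) * (∑ i, U i i) ^ 2) := by
    have e0 : (∑ k, x k * V k) ^ 2 ≤ Q * ∑ k, V k ^ 2 := by
      refine (Finset.sum_mul_sq_le_sq_mul_sq _ _ _).trans ?_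
      exact mul_le_mul_of_nonneg_right (by linarith) (by positivity)
    generalize (∑ k, x k * V k) = X at *
    generalize (∑ i, U i i) = f at *
    have e1 : θ * (p * X ^ 2) + c ^ 2 / θ * (Q * (Q * p) * f ^ 2) - 2 * c * (f * X) * (Q * p)
        = p * (θ * X - c * Q * f) ^ 2 / θ := by field_simp; ring
    have e2 : 0 ≤ p * (θ * X - c * Q * f) ^ 2 / θ := by positivity
    have e3 := mul_le_mul_of_nonneg_left e0 (mul_pos hθ hp).le
    linarith
  have h3 : ∀ a : ℝ, a * (p * ∑ k, V k ^ 2) ≤ |a| * (p * ∑ k, V k ^ 2) := fun a =>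
    mul_le_mul_of_nonneg_right (le_abs_self a) (by positivity)
  have h4 := h3 ((c + 1 / 2) * (2 * c - 2 - (c + 1 / 2)))
  have h5 := h3 (-(c * (2 * c - 2)))
  rw [abs_neg] at h5
  have e : (1 - 4 * c ^ 2) * (Q * p * ∑ k, V k ^ 2) = 8 * θ * (Q * p * ∑ k, V k ^ 2) := by rw [hc]
  simp only [Fin.sum_univ_three, hU 1 0, hU 2 0, hU 2 1] at *
  linarith

/-- The weighted gradient is controlled by the Laplacian and a lower order term. -/
lemma gradient_le_laplacian {c : ℝ} (hc : c ^ 2 < 1 / 4) :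
    ∃ C : ℝ, 0 ≤ C ∧ ∀ u, Smooth u → (∀ i, L2w (c - 1) (pd i u)) →
      (∀ i j, L2w c (pd i (pd j u))) →
      ∫ x, q x ^ (c - 1) * gradSq u x ≤
        C * ((∫ x, q x ^ c * lap u x ^ 2) + ∫ x, q x ^ (c - 2) * gradSq u x) := by
  set θ := (1 - 4 * c ^ 2) / 8 with hθ
  have hθ0 : 0 < θ := by rw [hθ]; linarith
  set c₁ := 1 + c ^ 2 / θ
  set c₂ := |(c + 1 / 2) * (2 * c - 2 - (c + 1 / 2))| + |c * (2 * c - 2)|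
  have hc₁ : 0 ≤ c₁ := by positivity
  have hc₂ : 0 ≤ c₂ := by positivity
  refine ⟨(c₁ + c₂) / θ, by positivity, fun u hu h1 h2 => ?_⟩
  have hN := fun i k => integral_null_form (t := c) (K := 1 + 2 * |c|) (smooth_q_rpow c)
    (hu.pd i) (hu.pd k) (by positivity) i k
    (fun x => by
      rw [abs_of_pos (q_rpow_pos c x)]
      exact le_mul_of_one_le_left (q_rpow_pos c x).le (by linarith [abs_nonneg c]))
    (fun l x => by
      have := q_rpow_mul_abs_pd_le (t := c) (K := 1) (f := fun _ => 1) contDiff_const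
        (fun x => by simp) (fun l x => by simp [pd, (q_rpow_pos _ x).le]) l x
      simpa [add_comm] using this)
    (fun l => h2 l i) (fun l => h2 l k) (h1 k)
  have hR := fun k => integral_radial (t := c) (hu.pd k) (h1 k) (fun l => h2 l k)
  have hlap : L2w c (lap u) := L2w.sum _ (fun i _ => h2 i i)
    fun i _ => ((hu.pd i).pd i).continuous
  have hNi := integrable_finsetSum Finset.univ fun i _ => integrable_finsetSum Finset.univ
    fun k _ => (hN i k).1
  have hN0 : ∫ x, ∑ i : Fin 3, ∑ k : Fin 3,
      (q x ^ c * (pd k (pd i u) x * pd i (pd k u) x - pd i (pd i u) x * pd k (pd k u) x)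
      + (pd i (fun x => q x ^ c) x * pd k (pd i u) x
        - pd k (fun x => q x ^ c) x * pd i (pd i u) x) * pd k u x) = 0 := by
    rw [integral_finsetSum _ fun i _ => integrable_finsetSum _ fun k _ => (hN i k).1]
    refine Finset.sum_eq_zero fun i _ => ?_
    rw [integral_finsetSum _ fun k _ => (hN i k).1]
    exact Finset.sum_eq_zero fun k _ => (hN i k).2
  have hRi := integrable_finsetSum Finset.univ fun k _ => (hR k).1
  have hR0 : ∫ x, ∑ k : Fin 3, ((2 * c + 1) * (q x ^ (c - 1) * pd k u x ^ 2)
      - (2 * c - 2) * (q x ^ (c - 2) * pd k u x ^ 2)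
      + 2 * (q x ^ (c - 1) * (pd k u x * ∑ i, x i * pd i (pd k u) x))) = 0 := by
    rw [integral_finsetSum _ fun k _ => (hR k).1]
    exact Finset.sum_eq_zero fun k _ => (hR k).2
  have hI := integral_le_of_null (c₁ := c₁) (c₂ := c₂) ((integrable_gradSq h1).const_mul θ)
    (hNi.add (hRi.const_mul (1 / 2)))
    (by rw [integral_add' hNi (hRi.const_mul (1 / 2)), hN0, integral_const_mul, hR0]; simp)
    hlap (integrable_gradSq fun i => (h1 i).mono (hu.pd i).continuous
      (by linarith : c - 2 ≤ c - 1)) (fun x => by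
      simp only [Pi.add_apply, pd_q_rpow, gradSq, lap]
      rw [q_rpow_sub_one c, q_rpow_sub_two]
      exact laplacian_algebra (x := x) (V := fun k => pd k u x) (U := fun i j => pd i (pd j u) x)
        (q_rpow_pos (c - 2) x) (q_eq_sum x) (fun i j => pd_comm hu i j x) hθ0
        (by rw [hθ]; ring))
  rw [integral_const_mul] at hI
  set F := ∫ x, q x ^ c * lap u x ^ 2
  set D := ∫ x, q x ^ (c - 2) * gradSq u x
  have hF : 0 ≤ F := integral_nonneg fun x => mul_nonneg (q_rpow_pos _ x).le (sq_nonneg _)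
  have hD : 0 ≤ D := integral_nonneg fun x =>
    mul_nonneg (q_rpow_pos _ x).le (gradSq_nonneg u x)
  rw [div_mul_eq_mul_div, le_div_iff₀ hθ0]
  nlinarith [mul_nonneg hc₁ hD, mul_nonneg hc₂ hF]

lemma integral_mono_rpow {s t : ℝ} (h : s ≤ t) {g : E3 → ℝ} (hg0 : ∀ x, 0 ≤ g x)
    (hs : Integrable fun x => q x ^ s * g x) (ht : Integrable fun x => q x ^ t * g x) :
    ∫ x, q x ^ s * g x ≤ ∫ x, q x ^ t * g x :=
  integral_mono hs ht fun x => mul_le_mul_of_nonneg_right (q_rpow_mono h x) (hg0 x)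

lemma DecayBound.lap_sq_le {ε lam K τ : ℝ} {a : Fin 3 → Fin 3 → E3 → ℝ} {b : Fin 3 → E3 → ℝ}
    {c u : E3 → ℝ} (h : DecayBound ε lam K a b c) (x : E3) :
    q x ^ (τ + 2) * lap u x ^ 2 ≤ 4 * (q x ^ (τ + 2) * diffOp a b c u x ^ 2)
      + (36 * K ^ 2 * (q x ^ (τ + 2 - 2 * ε) * hessSq u x)
      + 12 * K ^ 2 * (q x ^ (τ + 1 - 2 * ε) * gradSq u x + q x ^ (τ - 2 * ε) * u x ^ 2)) := by
  have p := q_rpow_pos (τ + 2) x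
  have h1 : (∑ i, ∑ j, (a i j x - if i = j then 1 else 0) * pd i (pd j u) x) ^ 2
      ≤ 9 * (K * q x ^ (-ε)) ^ 2 * hessSq u x := by
    simp only [hessSq, ← Finset.sum_product']
    refine (Finset.sum_mul_sq_le_sq_mul_sq _ _ _).trans ?_
    refine mul_le_mul_of_nonneg_right ?_ (Finset.sum_nonneg fun _ _ => sq_nonneg _)
    refine (Finset.sum_le_sum (g := fun _ => (K * q x ^ (-ε)) ^ 2) fun i _ => ?_).trans
      (le_of_eq ?_)
    · rw [← sq_abs]; exact pow_le_pow_left₀ (abs_nonneg _) (h.bound_a _ _ x) 2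
    · simp
  have h2 := h.lower_order_le (u := u) (τ := τ) x
  have e1 : q x ^ (τ + 2 - 2 * ε) = q x ^ (τ + 2) * (q x ^ (-ε)) ^ 2 := by
    rw [sq, ← q_rpow_add, ← q_rpow_add]; congr 1; ring
  have h3 : lap u x = diffOp a b c u x
      - (∑ i, ∑ j, (a i j x - if i = j then 1 else 0) * pd i (pd j u) x)
      - (∑ i, b i x * pd i u x) - c x * u x := by
    unfold diffOp lap
    simp only [sub_mul, Finset.sum_sub_distrib, ite_mul, one_mul, zero_mul, Finset.sum_ite_eq,
      Finset.mem_univ, if_true]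
    ring
  rw [h3, e1]
  have h1' := mul_le_mul_of_nonneg_left h1 p.le
  generalize (∑ i, ∑ j, (a i j x - if i = j then 1 else 0) * pd i (pd j u) x) = P at *
  generalize (∑ i, b i x * pd i u x) = S at *
  generalize c x * u x = R at *
  generalize diffOp a b c u x = F at *
  have h4 : (F - P - S - R) ^ 2 ≤ 4 * F ^ 2 + 4 * P ^ 2 + 4 * (S ^ 2 + R ^ 2) := by
    nlinarith [sq_nonneg (F + P), sq_nonneg (F + S), sq_nonneg (F + R), sq_nonneg (P - S),
      sq_nonneg (P - R), sq_nonneg (S - R)]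
  have h5 := mul_le_mul_of_nonneg_left h4 p.le
  have h6 : 0 ≤ K ^ 2 * (q x ^ (τ - 2 * ε) * u x ^ 2) := by
    have := q_rpow_pos (τ - 2 * ε) x
    positivity
  nlinarith

/-- The weighted `L²` norm is controlled by `Lu` and a weaker weighted `L²` norm. -/
lemma l2_le_diffOp_add_weaker {ε lam K τ : ℝ} (hε : 0 < ε) (hε' : 2 * ε ≤ 1) (hlam : 0 < lam)
    (hK : 0 ≤ K) (hτ : -(5 / 2) < τ) (hτ' : τ < -(3 / 2)) :
    ∃ C : ℝ, 0 ≤ C ∧ ∀ a b c, DecayBound ε lam K a b c → ∀ u, Smooth u → H2w τ u →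
      ∫ x, q x ^ τ * u x ^ 2 ≤ C * ((∫ x, q x ^ (τ + 2) * diffOp a b c u x ^ 2)
        + ∫ x, q x ^ (τ - 2 * ε) * u x ^ 2) := by
  obtain ⟨C1, hC1, h1⟩ := second_order_regularity (τ - 2 * ε) hε.le hlam hK
  obtain ⟨C2, hC2, h2⟩ := gradient_le_laplacian (c := τ + 2) (by nlinarith)
  set κ := τ + 3 / 2 with hκ
  have hκ0 : 0 < κ ^ 2 := sq_pos_of_neg (by linarith)
  set m := |κ * (2 * (τ + 1) - 2 - κ)|
  refine ⟨(C2 * (4 + 36 * K ^ 2 * (C1 + 1) + C1) + m) / κ ^ 2, by positivity,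
    fun a b c hD u hu hH => ?_⟩
  have hH' := hH.mono hu (by linarith : τ - 2 * ε ≤ τ)
  have k1 := h1 a b c hD u hu hH'
  have e0 : τ + 2 - 1 = τ + 1 := by ring
  have e1 : τ + 2 - 2 = τ := by ring
  have e2 : τ + 1 - 1 = τ := by ring
  have e3 : τ + 1 - 2 = τ - 1 := by ring
  have k2 := h2 u hu (by rw [e0]; exact hH.one) hH.two
  have k3 := hardy (t := τ + 1) (κ := κ) (by rw [hκ]; ring) hu (by rw [e2]; exact hH.zero) hH.one
  rw [e0, e1] at k2
  rw [e2, e3] at k3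
  have hL2 : Integrable (fun x => q x ^ (τ + 2) * diffOp a b c u x ^ 2) :=
    hD.l2w_diffOp hε.le hu hH
  have hL1 : Integrable (fun x => q x ^ (τ - 2 * ε + 2) * diffOp a b c u x ^ 2) :=
    hD.l2w_diffOp hε.le hu hH'
  have hlap : Integrable (fun x => q x ^ (τ + 2) * lap u x ^ 2) := L2w.sum _
    (fun i _ => hH.two i i) fun i _ => ((hu.pd i).pd i).continuous
  have hG := integrable_gradSq hH'.one
  have hHs := integrable_hessSq hH'.two
  have hU : Integrable (fun x => q x ^ (τ - 2 * ε) * u x ^ 2) := hH'.zero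
  have k4 := integral_mono_rpow (by linarith : τ - 2 * ε + 2 ≤ τ + 2)
    (fun x => sq_nonneg (diffOp a b c u x)) hL1 hL2
  have k5 := integral_mono_rpow (by linarith : τ ≤ τ - 2 * ε + 1)
    (gradSq_nonneg u) (integrable_gradSq fun i => (hH.one i).mono (hu.pd i).continuous
      (by linarith)) hG
  have k6 := integral_mono_rpow (by linarith : τ - 1 ≤ τ - 2 * ε) (fun x => sq_nonneg (u x))
    (hH.zero.mono hu.continuous (by linarith)) hU
  have k7 := integral_le_of_le_add₃ hlap hL2 hHs (hG.add hU) fun x => by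
    have := hD.lap_sq_le (u := u) (τ := τ) x
    rw [show τ + 2 - 2 * ε = τ - 2 * ε + 2 by ring,
      show τ + 1 - 2 * ε = τ - 2 * ε + 1 by ring] at this
    exact this
  rw [integral_add' hG hU] at k7
  have nn : ∀ (t : ℝ) (g : E3 → ℝ), (∀ x, 0 ≤ g x) → 0 ≤ ∫ x, q x ^ t * g x := fun t g hg =>
    integral_nonneg fun x => mul_nonneg (q_rpow_pos _ x).le (hg x)
  have n1 := nn (τ - 2 * ε + 2) _ (hessSq_nonneg u)
  have n2 := nn (τ - 2 * ε + 1) _ (gradSq_nonneg u)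
  have n3 := nn (τ - 2 * ε) _ fun x => sq_nonneg (u x)
  have n4 := nn (τ + 2) _ fun x => sq_nonneg (diffOp a b c u x)
  have n5 := nn (τ - 1) _ fun x => sq_nonneg (u x)
  set Hs := ∫ x, q x ^ (τ - 2 * ε + 2) * hessSq u x
  set G := ∫ x, q x ^ (τ - 2 * ε + 1) * gradSq u x
  set V := ∫ x, q x ^ (τ - 2 * ε) * u x ^ 2
  set F := ∫ x, q x ^ (τ + 2) * diffOp a b c u x ^ 2
  have m1 : G + Hs ≤ C1 * (F + V) :=
    k1.trans (mul_le_mul_of_nonneg_left (by linarith) hC1)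
  have m2 : ∫ x, q x ^ (τ + 2) * lap u x ^ 2 ≤ 4 * F + 36 * K ^ 2 * ((C1 + 1) * (F + V)) := by
    have : 36 * K ^ 2 * (Hs + G + V) ≤ 36 * K ^ 2 * ((C1 + 1) * (F + V)) :=
      mul_le_mul_of_nonneg_left (by linarith) (by positivity)
    nlinarith [mul_nonneg (sq_nonneg K) n2, mul_nonneg (sq_nonneg K) n3]
  have m3 : κ * (2 * (τ + 1) - 2 - κ) * (∫ x, q x ^ (τ - 1) * u x ^ 2) ≤ m * (F + V) :=
    mul_le_mul (le_abs_self _) (by linarith) n5 (abs_nonneg _)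
  have m4 : ∫ x, q x ^ (τ + 1) * gradSq u x ≤
      C2 * ((4 * F + 36 * K ^ 2 * ((C1 + 1) * (F + V))) + C1 * (F + V)) :=
    k2.trans (mul_le_mul_of_nonneg_left (by linarith) hC2)
  rw [div_mul_eq_mul_div, le_div_iff₀ hκ0]
  nlinarith [mul_nonneg hC2 n3]

lemma integral_weaker_le {ε η τ : ℝ} (hε : 0 < ε) (hη : 0 < η) (hτ : τ ≤ 0) :
    ∃ r : ℝ, 0 < r ∧ ∀ u : E3 → ℝ, Continuous u → L2w τ u →
      ∫ x, q x ^ (τ - 2 * ε) * u x ^ 2 ≤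
        η * (∫ x, q x ^ τ * u x ^ 2) + ∫ x in Metric.ball 0 r, u x ^ 2 := by
  set ρ := η ^ (-(1 / (2 * ε)))
  have hρ : 0 < ρ := Real.rpow_pos_of_pos hη _
  refine ⟨ρ + 1, by positivity, fun u hu hU => ?_⟩
  have hUi : Integrable (fun x => q x ^ τ * u x ^ 2) := hU
  have hB : IntegrableOn (fun x => u x ^ 2) (Metric.ball (0 : E3) (ρ + 1)) :=
    ((hu.pow 2).continuousOn.integrableOn_compact (isCompact_closedBall 0 (ρ + 1))).mono_set
      Metric.ball_subset_closedBall
  have hBi := hB.integrable_indicator Metric.isOpen_ball.measurableSet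
  rw [← integral_indicator Metric.isOpen_ball.measurableSet, ← integral_const_mul,
    ← integral_add (hUi.const_mul η) hBi]
  refine integral_mono (hU.mono hu (by linarith)) ((hUi.const_mul η).add hBi) fun x => ?_
  by_cases hx : x ∈ Metric.ball (0 : E3) (ρ + 1)
  · rw [Set.indicator_of_mem hx]
    have h1 : q x ^ (τ - 2 * ε) ≤ 1 :=
      Real.rpow_le_one_of_one_le_of_nonpos (one_le_q x) (by linarith)
    have h2 := mul_le_mul_of_nonneg_right h1 (sq_nonneg (u x))
    have h3 : 0 ≤ η * (q x ^ τ * u x ^ 2) := by have := q_rpow_pos τ x; positivity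
    linarith
  · rw [Set.indicator_of_notMem hx, add_zero, ← mul_assoc]
    refine mul_le_mul_of_nonneg_right ?_ (sq_nonneg _)
    rw [show τ - 2 * ε = -(2 * ε) + τ by ring, q_rpow_add]
    refine mul_le_mul_of_nonneg_right ?_ (q_rpow_pos τ x).le
    have hx' : ρ + 1 ≤ ‖x‖ := by simpa using hx
    have h1 : ρ ≤ q x := by unfold q; nlinarith
    refine (Real.rpow_le_rpow_of_nonpos hρ h1 (by linarith)).trans (le_of_eq ?_)
    rw [← Real.rpow_mul hη.le]
    rw [show -(1 / (2 * ε)) * -(2 * ε) = 1 by field_simp, Real.rpow_one]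

/-- The weighted `L²` norm is controlled by `Lu` and the `L²` norm on a ball. -/
lemma l2_le_diffOp_add_ball {ε lam K τ : ℝ} (hε : 0 < ε) (hε' : 2 * ε ≤ 1) (hlam : 0 < lam)
    (hK : 0 ≤ K) (hτ : -(5 / 2) < τ) (hτ' : τ < -(3 / 2)) :
    ∃ C r : ℝ, 0 ≤ C ∧ 0 < r ∧ ∀ a b c, DecayBound ε lam K a b c → ∀ u, Smooth u → H2w τ u →
      ∫ x, q x ^ τ * u x ^ 2 ≤ C * ((∫ x, q x ^ (τ + 2) * diffOp a b c u x ^ 2)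
        + ∫ x in Metric.ball 0 r, u x ^ 2) := by
  obtain ⟨C, hC, h1⟩ := l2_le_diffOp_add_weaker hε hε' hlam hK hτ hτ'
  obtain ⟨r, hr, h2⟩ := integral_weaker_le (η := 1 / (2 * (C + 1))) hε (by positivity)
    (by linarith : τ ≤ 0)
  refine ⟨2 * C, r, by positivity, hr, fun a b c hD u hu hH => ?_⟩
  have k1 := h1 a b c hD u hu hH
  have k2 := mul_le_mul_of_nonneg_left (h2 u hu.continuous hH.zero) hC
  have hU : 0 ≤ ∫ x, q x ^ τ * u x ^ 2 := integral_nonneg fun x =>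
    mul_nonneg (q_rpow_pos _ x).le (sq_nonneg _)
  set U := ∫ x, q x ^ τ * u x ^ 2
  have k3 : C * (1 / (2 * (C + 1)) * U) ≤ U / 2 := by
    have : U / 2 - C * (1 / (2 * (C + 1)) * U) = U / (2 * (C + 1)) := by field_simp; ring
    have : 0 ≤ U / (2 * (C + 1)) := by positivity
    linarith
  linarith

/-- The squared weighted `L²` norm, with values in `ℝ≥0∞`. -/
noncomputable def wL2 (t : ℝ) (f : E3 → ℝ) : ENNReal := ∫⁻ x, ENNReal.ofReal (q x ^ t * f x ^ 2)

/-- A squared weighted Sobolev norm built from iterated partial derivatives. -/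
noncomputable def wNorm : ℕ → ℝ → (E3 → ℝ) → ENNReal
  | 0, t, f => wL2 t f
  | s + 1, t, f => wL2 t f + ∑ i, wNorm s (t + 1) (pd i f)

lemma wNorm_zero (t : ℝ) (f : E3 → ℝ) : wNorm 0 t f = wL2 t f := rfl

lemma wNorm_succ (s : ℕ) (t : ℝ) (f : E3 → ℝ) :
    wNorm (s + 1) t f = wL2 t f + ∑ i, wNorm s (t + 1) (pd i f) := rfl

lemma wL2_mono {s t : ℝ} (h : s ≤ t) (f : E3 → ℝ) : wL2 s f ≤ wL2 t f :=
  lintegral_mono fun x => ENNReal.ofReal_le_ofReal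
    (mul_le_mul_of_nonneg_right (q_rpow_mono h x) (sq_nonneg _))

lemma wNorm_mono_weight (n : ℕ) {s t : ℝ} (h : s ≤ t) (f : E3 → ℝ) :
    wNorm n s f ≤ wNorm n t f := by
  induction n generalizing s t f with
  | zero => exact wL2_mono h f
  | succ n ih =>
    exact add_le_add (wL2_mono h f) (Finset.sum_le_sum fun i _ => ih (by linarith) _)

lemma wL2_le_wNorm (n : ℕ) (t : ℝ) (f : E3 → ℝ) : wL2 t f ≤ wNorm n t f := by
  cases n with
  | zero => exact le_rfl
  | succ n => exact le_self_add

lemma wNorm_le_succ (n : ℕ) (t : ℝ) (f : E3 → ℝ) : wNorm n t f ≤ wNorm (n + 1) t f := by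
  induction n generalizing t f with
  | zero => exact wL2_le_wNorm 1 t f
  | succ n ih => exact add_le_add le_rfl (Finset.sum_le_sum fun i _ => ih _ _)

lemma wNorm_mono_order {m n : ℕ} (h : m ≤ n) (t : ℝ) (f : E3 → ℝ) : wNorm m t f ≤ wNorm n t f :=
  monotone_nat_of_le_succ (f := fun n => wNorm n t f) (fun n => wNorm_le_succ n t f) h

lemma wNorm_pd_le (n : ℕ) (t : ℝ) (f : E3 → ℝ) (i : Fin 3) :
    wNorm n (t + 1) (pd i f) ≤ wNorm (n + 1) t f :=
  (Finset.single_le_sum (f := fun i => wNorm n (t + 1) (pd i f)) (fun _ _ => zero_le)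
    (Finset.mem_univ i)).trans le_add_self

lemma measurable_wL2_integrand (t : ℝ) {f : E3 → ℝ} (hf : Continuous f) :
    Measurable fun x => ENNReal.ofReal (q x ^ t * f x ^ 2) :=
  ((smooth_q_rpow t).continuous.mul (hf.pow 2)).measurable.ennreal_ofReal

lemma wL2_add_le (t : ℝ) {f g : E3 → ℝ} (hf : Continuous f) :
    wL2 t (fun x => f x + g x) ≤ 2 * (wL2 t f + wL2 t g) := by
  unfold wL2
  rw [← lintegral_add_left (measurable_wL2_integrand t hf), ← lintegral_const_mul' _ _ (by simp)]
  refine lintegral_mono fun x => ?_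
  have p := q_rpow_pos t x
  rw [← ENNReal.ofReal_add (by positivity) (by positivity),
    show (2 : ENNReal) = ENNReal.ofReal 2 by simp, ← ENNReal.ofReal_mul (by norm_num)]
  refine ENNReal.ofReal_le_ofReal ?_
  nlinarith [mul_nonneg p.le (sq_nonneg (f x - g x))]

lemma pd_add_fun {f g : E3 → ℝ} (hf : Smooth f) (hg : Smooth g) (i : Fin 3) :
    pd i (fun x => f x + g x) = fun x => pd i f x + pd i g x :=
  funext fun x => pd_add hf hg i x

lemma wNorm_add_le (n : ℕ) (t : ℝ) {f g : E3 → ℝ} (hf : Smooth f) (hg : Smooth g) :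
    wNorm n t (fun x => f x + g x) ≤ 2 * (wNorm n t f + wNorm n t g) := by
  induction n generalizing t f g with
  | zero => exact wL2_add_le t hf.continuous
  | succ n ih =>
    simp only [wNorm_succ, pd_add_fun hf hg]
    calc _ ≤ 2 * (wL2 t f + wL2 t g)
          + ∑ i, 2 * (wNorm n (t + 1) (pd i f) + wNorm n (t + 1) (pd i g)) :=
          add_le_add (wL2_add_le t hf.continuous)
            (Finset.sum_le_sum fun i _ => ih (t + 1) (hf.pd i) (hg.pd i))
      _ = _ := by rw [← Finset.mul_sum, Finset.sum_add_distrib]; ring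

lemma wNorm_sum_le (n : ℕ) (t : ℝ) {f : Fin 3 → E3 → ℝ} (hf : ∀ i, Smooth (f i)) :
    wNorm n t (fun x => ∑ i, f i x) ≤ 4 * ∑ i, wNorm n t (f i) := by
  simp only [Fin.sum_univ_three]
  refine (wNorm_add_le n t ((hf 0).add (hf 1)) (hf 2)).trans ?_
  refine (mul_le_mul_right (add_le_add_left (wNorm_add_le n t (hf 0) (hf 1)) _) 2).trans ?_
  have : wNorm n t (f 2) ≤ 2 * wNorm n t (f 2) := by
    rw [two_mul]; exact le_self_add
  refine (mul_le_mul_right (add_le_add_right this _) 2).trans (le_of_eq ?_)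
  ring

lemma wNorm_neg (n : ℕ) (t : ℝ) (f : E3 → ℝ) : wNorm n t (fun x => -f x) = wNorm n t f := by
  induction n generalizing t f with
  | zero => simp [wNorm_zero, wL2]
  | succ n ih =>
    have : ∀ i, pd i (fun x => -f x) = fun x => -pd i f x := fun i => by
      funext x; simp [pd, fderiv_fun_neg]
    simp only [wNorm_succ, this, ih]
    simp [wL2]

lemma fderiv_apply_eq_sum_pd (f : E3 → ℝ) (z y : E3) :
    fderiv ℝ f z y = ∑ i, y i * pd i f z := by
  have : y = ∑ i, y i • EuclideanSpace.single i (1 : ℝ) := by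
    ext j
    simp [Finset.sum_apply, Pi.single_apply]
  conv_lhs => rw [this, map_sum]
  simp [pd]

lemma hasDerivAt_comp_line {f : E3 → ℝ} (hf : Smooth f) (x y : E3) (t : ℝ) :
    HasDerivAt (fun t : ℝ => f (x + t • y)) (∑ i, y i * pd i f (x + t • y)) t := by
  have h1 : HasDerivAt (fun t : ℝ => x + t • y) y t := by
    simpa using ((hasDerivAt_id t).smul_const y).const_add x
  rw [← fderiv_apply_eq_sum_pd]
  exact (hf.diffAt _).hasFDerivAt.comp_hasDerivAt t h1

lemma hasDerivAt_deriv_line {f : E3 → ℝ} (hf : Smooth f) (x y : E3) (t : ℝ) :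
    HasDerivAt (fun t : ℝ => ∑ i, y i * pd i f (x + t • y))
      (∑ i, y i * ∑ j, y j * pd j (pd i f) (x + t • y)) t :=
  HasDerivAt.fun_sum fun i _ => (hasDerivAt_comp_line (hf.pd i) x y t).const_mul (y i)

lemma continuous_comp_line {f : E3 → ℝ} (hf : Continuous f) (x y : E3) :
    Continuous fun t : ℝ => f (x + t • y) := hf.comp (by fun_prop)

lemma taylor_line {f : E3 → ℝ} (hf : Smooth f) (x y : E3) :
    f x = f (x + y) - (∑ i, y i * pd i f (x + y))
      + ∫ t in (0 : ℝ)..1, t * ∑ i, y i * ∑ j, y j * pd j (pd i f) (x + t • y) := by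
  have hc : Continuous fun t : ℝ => t * ∑ i, y i * ∑ j, y j * pd j (pd i f) (x + t • y) :=
    continuous_id.mul (continuous_finsetSum _ fun i _ => continuous_const.mul
      (continuous_finsetSum _ fun j _ => continuous_const.mul
        (continuous_comp_line ((hf.pd i).pd j).continuous x y)))
  have h := intervalIntegral.integral_eq_sub_of_hasDerivAt (a := 0) (b := 1)
    (f := fun t : ℝ => t * (∑ i, y i * pd i f (x + t • y)) - f (x + t • y))
    (f' := fun t : ℝ => t * ∑ i, y i * ∑ j, y j * pd j (pd i f) (x + t • y))
    (fun t _ => by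
      have h1 := ((hasDerivAt_id t).mul (hasDerivAt_deriv_line hf x y t)).sub
        (hasDerivAt_comp_line hf x y t)
      refine h1.congr_deriv ?_
      simp) (hc.intervalIntegrable 0 1)
  rw [h]
  simp only [one_mul, one_smul, zero_mul, zero_smul, add_zero]
  ring

lemma sq_sum_mul_le_norm (y : E3) (v : Fin 3 → ℝ) :
    (∑ i, y i * v i) ^ 2 ≤ ‖y‖ ^ 2 * ∑ i, v i ^ 2 := by
  rw [EuclideanSpace.real_norm_sq_eq]
  exact Finset.sum_mul_sq_le_sq_mul_sq _ _ _

lemma sq_integral_id_mul_le {g : ℝ → ℝ} (hg : Continuous g) :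
    (∫ t in (0 : ℝ)..1, t * g t) ^ 2 ≤ 2 * ∫ t in (0 : ℝ)..1, t ^ (5 / 2 : ℝ) * g t ^ 2 := by
  set I := ∫ t in (0 : ℝ)..1, t * g t with hI
  have i1 : IntervalIntegrable (fun t : ℝ => t ^ (5 / 2 : ℝ) * g t ^ 2) volume 0 1 :=
    ((continuous_id.rpow_const fun _ => Or.inr (by norm_num)).mul (hg.pow 2)).intervalIntegrable _ _
  have i2 : IntervalIntegrable (fun t : ℝ => t * g t) volume 0 1 :=
    (continuous_id.mul hg).intervalIntegrable _ _
  have i3 : IntervalIntegrable (fun t : ℝ => t ^ (-(1 / 2) : ℝ)) volume 0 1 :=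
    intervalIntegral.intervalIntegrable_rpow' (by norm_num)
  have e3 : ∫ t in (0 : ℝ)..1, t ^ (-(1 / 2) : ℝ) = 2 := by
    rw [integral_rpow (Or.inl (by norm_num))]; norm_num
  have h : 0 ≤ ∫ t in (0 : ℝ)..1, (t ^ (5 / 2 : ℝ) * g t ^ 2 - I * (t * g t)
      + I ^ 2 / 4 * t ^ (-(1 / 2) : ℝ)) := by
    rw [intervalIntegral.integral_of_le (by norm_num)]
    refine setIntegral_nonneg measurableSet_Ioc fun t ht => ?_
    have e1 : t ^ (5 / 2 : ℝ) = t ^ (-(1 / 2) : ℝ) * (t ^ (3 / 2 : ℝ)) ^ 2 := by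
      rw [← Real.rpow_natCast, ← Real.rpow_mul ht.1.le, ← Real.rpow_add ht.1]
      norm_num
    have e2 : t = t ^ (-(1 / 2) : ℝ) * t ^ (3 / 2 : ℝ) := by
      rw [← Real.rpow_add ht.1]
      norm_num
    have e4 : t ^ (5 / 2 : ℝ) * g t ^ 2 - I * (t * g t) + I ^ 2 / 4 * t ^ (-(1 / 2) : ℝ) =
        t ^ (-(1 / 2) : ℝ) * (t ^ (3 / 2 : ℝ) * g t - I / 2) ^ 2 := by
      linear_combination g t ^ 2 * e1 - I * g t * e2
    rw [e4]
    exact mul_nonneg (Real.rpow_nonneg ht.1.le _) (sq_nonneg _)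
  rw [intervalIntegral.integral_add (i1.sub (i2.const_mul _)) (i3.const_mul _),
    intervalIntegral.integral_sub i1 (i2.const_mul _), intervalIntegral.integral_const_mul,
    intervalIntegral.integral_const_mul, e3, ← hI] at h
  linarith

lemma sq_le_taylor {f : E3 → ℝ} (hf : Smooth f) (x : E3) {y : E3} {R : ℝ} (hy : ‖y‖ ≤ R) :
    f x ^ 2 ≤ 3 * (f (x + y) ^ 2 + R ^ 2 * gradSq f (x + y)
      + 2 * R ^ 4 * ∫ t in (0 : ℝ)..1, t ^ (5 / 2 : ℝ) * hessSq f (x + t • y)) := by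
  have hR : ‖y‖ ^ 2 ≤ R ^ 2 := pow_le_pow_left₀ (norm_nonneg _) hy 2
  have hg : Continuous fun t : ℝ => ∑ i, y i * ∑ j, y j * pd j (pd i f) (x + t • y) :=
    continuous_finsetSum _ fun i _ => continuous_const.mul
      (continuous_finsetSum _ fun j _ => continuous_const.mul
        (continuous_comp_line ((hf.pd i).pd j).continuous x y))
  have hh : Continuous (hessSq f) := continuous_finsetSum _ fun i _ =>
    continuous_finsetSum _ fun j _ => ((hf.pd j).pd i).continuous.pow 2
  have h1 := sq_integral_id_mul_le hg
  have h2 : ∫ t in (0 : ℝ)..1, t ^ (5 / 2 : ℝ)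
        * (∑ i, y i * ∑ j, y j * pd j (pd i f) (x + t • y)) ^ 2 ≤
      R ^ 4 * ∫ t in (0 : ℝ)..1, t ^ (5 / 2 : ℝ) * hessSq f (x + t • y) := by
    rw [← intervalIntegral.integral_const_mul]
    have hp : Continuous fun t : ℝ => t ^ (5 / 2 : ℝ) :=
      continuous_id.rpow_const fun _ => Or.inr (by norm_num)
    refine intervalIntegral.integral_mono_on (by norm_num)
      ((hp.mul (hg.pow 2)).intervalIntegrable _ _)
      ((continuous_const.mul (hp.mul (continuous_comp_line hh x y))).intervalIntegrable _ _)
      fun t ht => ?_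
    have e1 := sq_sum_mul_le_norm y fun i => ∑ j, y j * pd j (pd i f) (x + t • y)
    have e2 : ∑ i, (∑ j, y j * pd j (pd i f) (x + t • y)) ^ 2
        ≤ ‖y‖ ^ 2 * hessSq f (x + t • y) := by
      unfold hessSq
      rw [Finset.sum_comm, Finset.mul_sum]
      exact Finset.sum_le_sum fun i _ => sq_sum_mul_le_norm y fun j => pd j (pd i f) (x + t • y)
    have e3 : (∑ i, y i * ∑ j, y j * pd j (pd i f) (x + t • y)) ^ 2
        ≤ R ^ 4 * hessSq f (x + t • y) :=
      calc _ ≤ ‖y‖ ^ 2 * (‖y‖ ^ 2 * hessSq f (x + t • y)) :=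
            e1.trans (mul_le_mul_of_nonneg_left e2 (sq_nonneg _))
        _ ≤ R ^ 2 * (R ^ 2 * hessSq f (x + t • y)) := by
            have := hessSq_nonneg f (x + t • y)
            gcongr
        _ = _ := by ring
    have := mul_le_mul_of_nonneg_left e3 (Real.rpow_nonneg ht.1 (5 / 2))
    linarith
  have h3 : (∑ i, y i * pd i f (x + y)) ^ 2 ≤ R ^ 2 * gradSq f (x + y) :=
    (sq_sum_mul_le_norm y _).trans (mul_le_mul_of_nonneg_right hR (gradSq_nonneg f _))
  have h4 := taylor_line hf x y
  generalize (∫ t in (0 : ℝ)..1, t * ∑ i, y i * ∑ j, y j * pd j (pd i f) (x + t • y)) = T at *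
  generalize (∑ i, y i * pd i f (x + y)) = D at *
  rw [h4]
  generalize f (x + y) = w at *
  nlinarith [sq_nonneg (w + D), sq_nonneg (w - T), sq_nonneg (D + T)]

lemma lintegral_ball_comp_smul_le {h : E3 → ENNReal} (hh : Measurable h) (x : E3) {t R : ℝ}
    (ht : 0 < t) (ht1 : t ≤ 1) :
    ∫⁻ y in Metric.ball (0 : E3) R, h (x + t • y) ≤
      ENNReal.ofReal (t ^ (-3 : ℝ)) * ∫⁻ z in Metric.ball x R, h z := by
  set H := (Metric.ball x R).indicator h
  have hH : Measurable H := hh.indicator Metric.isOpen_ball.measurableSet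
  have hH' : Measurable fun z => H (x + z) := hH.comp (measurable_const_add x)
  calc ∫⁻ y in Metric.ball (0 : E3) R, h (x + t • y)
      = ∫⁻ y, (Metric.ball (0 : E3) R).indicator (fun y => h (x + t • y)) y :=
        (lintegral_indicator Metric.isOpen_ball.measurableSet _).symm
    _ ≤ ∫⁻ y, H (x + t • y) := by
        refine lintegral_mono fun y => ?_
        by_cases hy : y ∈ Metric.ball (0 : E3) R
        · have hy' : ‖y‖ < R := by simpa using hy
          have : x + t • y ∈ Metric.ball x R := by
            rw [mem_ball_iff_norm, add_sub_cancel_left, norm_smul, Real.norm_of_nonneg ht.le]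
            exact (mul_le_of_le_one_left (norm_nonneg y) ht1).trans_lt hy'
          simp only [H, Set.indicator_of_mem hy, Set.indicator_of_mem this, le_refl]
        · simp [Set.indicator_of_notMem hy]
    _ = ∫⁻ z, H (x + z) ∂(Measure.map (t • ·) (volume : Measure E3)) :=
        (lintegral_map hH' (measurable_const_smul t)).symm
    _ = _ := by
        rw [Measure.map_addHaar_smul _ ht.ne', lintegral_smul_measure,
          lintegral_add_left_eq_self (fun z => H z) x, smul_eq_mul,
          lintegral_indicator Metric.isOpen_ball.measurableSet]
        congr 2
        rw [abs_of_pos (by positivity), Real.rpow_neg ht.le]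
        simp

lemma lintegral_taylor_remainder_le {h : E3 → ℝ} (hh : Continuous h) (h0 : ∀ z, 0 ≤ h z) (x : E3)
    (R : ℝ) :
    ∫⁻ y in Metric.ball (0 : E3) R,
        ENNReal.ofReal (∫ t in (0 : ℝ)..1, t ^ (5 / 2 : ℝ) * h (x + t • y)) ≤
      2 * ∫⁻ z in Metric.ball x R, ENNReal.ofReal (h z) := by
  have hp : Continuous fun t : ℝ => t ^ (5 / 2 : ℝ) :=
    continuous_id.rpow_const fun _ => Or.inr (by norm_num)
  have h1 : ∀ y : E3, ENNReal.ofReal (∫ t in (0 : ℝ)..1, t ^ (5 / 2 : ℝ) * h (x + t • y)) =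
      ∫⁻ t in Set.Ioc (0 : ℝ) 1, ENNReal.ofReal (t ^ (5 / 2 : ℝ) * h (x + t • y)) := by
    intro y
    rw [intervalIntegral.integral_of_le (by norm_num)]
    refine ofReal_integral_eq_lintegral_ofReal
      ((hp.mul (continuous_comp_line hh x y)).intervalIntegrable 0 1).1 ?_
    filter_upwards [ae_restrict_mem measurableSet_Ioc] with t ht
    exact mul_nonneg (Real.rpow_nonneg ht.1.le _) (h0 _)
  simp_rw [h1]
  rw [lintegral_lintegral_swap (by
    refine Measurable.aemeasurable (Measurable.ennreal_ofReal (Continuous.measurable ?_))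
    exact (hp.comp continuous_snd).mul (hh.comp (by fun_prop)))]
  set J := ∫⁻ z in Metric.ball x R, ENNReal.ofReal (h z)
  have h2 : ∀ t ∈ Set.Ioc (0 : ℝ) 1,
      ∫⁻ y in Metric.ball (0 : E3) R, ENNReal.ofReal (t ^ (5 / 2 : ℝ) * h (x + t • y)) ≤
        ENNReal.ofReal (t ^ (-(1 / 2) : ℝ)) * J := by
    intro t ht
    have p := Real.rpow_pos_of_pos ht.1 (5 / 2)
    simp_rw [ENNReal.ofReal_mul p.le]
    rw [lintegral_const_mul' _ _ ENNReal.ofReal_ne_top]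
    refine (mul_le_mul_right (lintegral_ball_comp_smul_le hh.measurable.ennreal_ofReal x ht.1
      ht.2) _).trans (le_of_eq ?_)
    rw [← mul_assoc, ← ENNReal.ofReal_mul p.le, ← Real.rpow_add ht.1]
    norm_num
    rfl
  refine (setLIntegral_mono' measurableSet_Ioc h2).trans ?_
  rw [lintegral_mul_const _ (by fun_prop)]
  refine mul_le_mul_left (le_of_eq ?_) _
  rw [← ofReal_integral_eq_lintegral_ofReal
    (intervalIntegral.intervalIntegrable_rpow' (by norm_num) : IntervalIntegrable _ volume 0 1).1
    (by filter_upwards [ae_restrict_mem measurableSet_Ioc] with t ht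
        exact Real.rpow_nonneg ht.1.le _),
    ← intervalIntegral.integral_of_le (by norm_num), integral_rpow (Or.inl (by norm_num))]
  norm_num

lemma ofReal_three_mul_add {A B J r r' : ℝ} (hA : 0 ≤ A) (hB : 0 ≤ B) (hJ : 0 ≤ J) (hr : 0 ≤ r)
    (hr' : 0 ≤ r') : ENNReal.ofReal (3 * (A + (r * B + 2 * r' * J))) =
      3 * (ENNReal.ofReal A + (ENNReal.ofReal r * ENNReal.ofReal B
        + 2 * ENNReal.ofReal r' * ENNReal.ofReal J)) := by
  rw [ENNReal.ofReal_mul (by norm_num), ENNReal.ofReal_add hA (by positivity),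
    ENNReal.ofReal_add (by positivity) (by positivity), ENNReal.ofReal_mul hr,
    ENNReal.ofReal_mul (by positivity), ENNReal.ofReal_mul (by norm_num)]
  simp

/-- Sobolev's inequality on a ball, with explicit scaling. -/
lemma sq_mul_volume_ball_le {f : E3 → ℝ} (hf : Smooth f) (x : E3) (R : ℝ) :
    ENNReal.ofReal (f x ^ 2) * volume (Metric.ball (0 : E3) R) ≤
      3 * ((∫⁻ z in Metric.ball x R, ENNReal.ofReal (f z ^ 2))
        + ENNReal.ofReal (R ^ 2) * (∫⁻ z in Metric.ball x R, ENNReal.ofReal (gradSq f z))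
        + 4 * ENNReal.ofReal (R ^ 4) * ∫⁻ z in Metric.ball x R, ENNReal.ofReal (hessSq f z)) := by
  have hg : Continuous (gradSq f) := continuous_finsetSum _ fun i _ => (hf.pd i).continuous.pow 2
  have hh : Continuous (hessSq f) := continuous_finsetSum _ fun i _ =>
    continuous_finsetSum _ fun j _ => ((hf.pd j).pd i).continuous.pow 2
  have hshift : ∀ {g : E3 → ℝ}, Continuous g → ∫⁻ y in Metric.ball (0 : E3) R,
      ENNReal.ofReal (g (x + y)) ≤ ∫⁻ z in Metric.ball x R, ENNReal.ofReal (g z) := fun hc => by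
    simpa using lintegral_ball_comp_smul_le hc.measurable.ennreal_ofReal x one_pos le_rfl (R := R)
  have h1 : ENNReal.ofReal (f x ^ 2) * volume (Metric.ball (0 : E3) R) =
      ∫⁻ _ in Metric.ball (0 : E3) R, ENNReal.ofReal (f x ^ 2) := by
    rw [setLIntegral_const]
  rw [h1]
  have h2 : ∀ y ∈ Metric.ball (0 : E3) R, ENNReal.ofReal (f x ^ 2) ≤
      3 * (ENNReal.ofReal (f (x + y) ^ 2) + (ENNReal.ofReal (R ^ 2) * ENNReal.ofReal (gradSq f (x + y))
      + 2 * ENNReal.ofReal (R ^ 4) * ENNReal.ofReal (∫ t in (0 : ℝ)..1,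
        t ^ (5 / 2 : ℝ) * hessSq f (x + t • y)))) := by
    intro y hy
    have hy' : ‖y‖ ≤ R := by simpa using (Metric.mem_ball.1 hy).le
    have hJ : 0 ≤ ∫ t in (0 : ℝ)..1, t ^ (5 / 2 : ℝ) * hessSq f (x + t • y) :=
      intervalIntegral.integral_nonneg (by norm_num) fun t ht =>
        mul_nonneg (Real.rpow_nonneg ht.1 _) (hessSq_nonneg f _)
    have hG := gradSq_nonneg f (x + y)
    refine (ENNReal.ofReal_le_ofReal (sq_le_taylor hf x hy')).trans (le_of_eq ?_)
    rw [add_assoc]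
    exact ofReal_three_mul_add (sq_nonneg _) hG hJ (sq_nonneg R) (by positivity)
  refine (setLIntegral_mono' Metric.isOpen_ball.measurableSet h2).trans ?_
  rw [lintegral_const_mul' _ _ (by simp)]
  refine mul_le_mul_right ?_ _
  rw [lintegral_add_left (by
      exact ((hf.continuous.comp (continuous_const.add continuous_id)).pow
        2).measurable.ennreal_ofReal),
    lintegral_add_left (by
      exact (hg.comp (continuous_const.add continuous_id)).measurable.ennreal_ofReal.const_mul _),
    lintegral_const_mul' _ _ (by simp), lintegral_const_mul' _ _ (by finiteness), add_assoc]
  refine add_le_add (hshift (hf.continuous.pow 2)) (add_le_add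
    (mul_le_mul_right (hshift hg) _) ?_)
  refine (mul_le_mul_right (lintegral_taylor_remainder_le hh (hessSq_nonneg f) x R) _).trans
    (le_of_eq ?_)
  ring

lemma q_le_four_mul {x z : E3} (h : ‖z - x‖ ^ 2 ≤ q x / 4) : q z ≤ 4 * q x ∧ q x ≤ 4 * q z := by
  have h1 : ‖z‖ ^ 2 ≤ 2 * (‖x‖ ^ 2 + ‖z - x‖ ^ 2) := by
    have := norm_add_le x (z - x)
    rw [add_sub_cancel] at this
    nlinarith [sq_nonneg (‖x‖ - ‖z - x‖), norm_nonneg z, norm_nonneg x, norm_nonneg (z - x)]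
  have h2 : ‖x‖ ^ 2 ≤ 2 * (‖z‖ ^ 2 + ‖z - x‖ ^ 2) := by
    have := norm_sub_le z (z - x)
    rw [sub_sub_cancel] at this
    nlinarith [sq_nonneg (‖z‖ - ‖z - x‖), norm_nonneg z, norm_nonneg x, norm_nonneg (z - x)]
  have h3 := one_le_q x
  have h4 := one_le_q z
  unfold q at *
  constructor <;> linarith

lemma q_rpow_le_of_le_four_mul (p : ℝ) {x z : E3} (h : q z ≤ 4 * q x) (h' : q x ≤ 4 * q z) :
    q x ^ p ≤ 4 ^ |p| * q z ^ p := by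
  rcases le_total 0 p with hp | hp
  · rw [abs_of_nonneg hp, ← Real.mul_rpow (by norm_num) (q_pos z).le]
    exact Real.rpow_le_rpow (q_pos x).le h' hp
  · rw [abs_of_nonpos hp]
    have h1 : q z / 4 ≤ q x := by linarith
    have h2 := Real.rpow_le_rpow_of_nonpos (by have := q_pos z; positivity) h1 hp
    rw [Real.div_rpow (q_pos z).le (by norm_num)] at h2
    rw [Real.rpow_neg (by norm_num)]
    refine h2.trans (le_of_eq ?_)
    ring

lemma ofReal_q_rpow_mul_lintegral_ball_le (p : ℝ) (h : E3 → ℝ) (x : E3) :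
    ENNReal.ofReal (q x ^ p) * ∫⁻ z in Metric.ball x (√(q x) / 2), ENNReal.ofReal (h z) ≤
      ENNReal.ofReal (4 ^ |p|) * ∫⁻ z, ENNReal.ofReal (q z ^ p * h z) := by
  rw [← lintegral_const_mul' _ _ ENNReal.ofReal_ne_top,
    ← lintegral_const_mul' _ _ ENNReal.ofReal_ne_top]
  refine (setLIntegral_mono' Metric.isOpen_ball.measurableSet fun z hz => ?_).trans
    (setLIntegral_le_lintegral _ _)
  have hz' : ‖z - x‖ ^ 2 ≤ q x / 4 := by
    have h1 : ‖z - x‖ ≤ √(q x) / 2 := (mem_ball_iff_norm.1 hz).le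
    have h2 := pow_le_pow_left₀ (norm_nonneg _) h1 2
    rw [div_pow, Real.sq_sqrt (q_pos x).le] at h2
    linarith
  obtain ⟨h1, h2⟩ := q_le_four_mul hz'
  rw [ENNReal.ofReal_mul (p := q z ^ p) (q_rpow_pos p z).le, ← mul_assoc,
    ← ENNReal.ofReal_mul (p := 4 ^ |p|) (by positivity)]
  exact mul_le_mul_left (ENNReal.ofReal_le_ofReal (q_rpow_le_of_le_four_mul p h1 h2)) _

lemma lintegral_q_rpow_mul_gradSq (t : ℝ) {f : E3 → ℝ} (hf : Smooth f) :
    ∫⁻ z, ENNReal.ofReal (q z ^ t * gradSq f z) = ∑ i, wL2 t (pd i f) := by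
  unfold wL2 gradSq
  rw [← lintegral_finsetSum _ fun i _ => measurable_wL2_integrand t (hf.pd i).continuous]
  refine lintegral_congr fun z => ?_
  rw [Finset.mul_sum, ENNReal.ofReal_sum_of_nonneg]
  exact fun i _ => mul_nonneg (q_rpow_pos t z).le (sq_nonneg _)

lemma lintegral_q_rpow_mul_hessSq (t : ℝ) {f : E3 → ℝ} (hf : Smooth f) :
    ∫⁻ z, ENNReal.ofReal (q z ^ t * hessSq f z) = ∑ j, ∑ i, wL2 t (pd i (pd j f)) := by
  simp_rw [← lintegral_q_rpow_mul_gradSq t (hf.pd _)]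
  rw [← lintegral_finsetSum]
  · refine lintegral_congr fun z => ?_
    rw [← ENNReal.ofReal_sum_of_nonneg, ← Finset.mul_sum]
    · congr 2
      exact Finset.sum_comm
    · exact fun i _ => mul_nonneg (q_rpow_pos t z).le (gradSq_nonneg _ _)
  · intro j _
    refine ((smooth_q_rpow t).continuous.mul (?_ : Continuous (gradSq (pd j f)))).measurable.ennreal_ofReal
    exact continuous_finsetSum _ fun i _ => ((hf.pd j).pd i).continuous.pow 2

lemma wNorm_two (t : ℝ) {f : E3 → ℝ} (hf : Smooth f) :
    wNorm 2 t f = wL2 t f + (∫⁻ z, ENNReal.ofReal (q z ^ (t + 1) * gradSq f z))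
      + ∫⁻ z, ENNReal.ofReal (q z ^ (t + 2) * hessSq f z) := by
  rw [lintegral_q_rpow_mul_gradSq _ hf, lintegral_q_rpow_mul_hessSq _ hf]
  simp only [wNorm_succ, wNorm_zero, Finset.sum_add_distrib, add_assoc]
  norm_num

/-- The weighted Sobolev embedding `H_{2,t} ⊆ C⁰` with weight `q ^ (t + 3 / 2)`. -/
lemma sobolev_embedding (t : ℝ) : ∃ C : ENNReal, C ≠ ⊤ ∧ ∀ f, Smooth f → ∀ x,
    ENNReal.ofReal (q x ^ (t + 3 / 2) * f x ^ 2) ≤ C * wNorm 2 t f := by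
  set v := volume (Metric.ball (0 : E3) 1) with hv
  have v0 : v ≠ 0 := (Metric.measure_ball_pos _ _ one_pos).ne'
  have vT : v ≠ ⊤ := measure_ball_lt_top.ne
  set K := ENNReal.ofReal (4 ^ |t|) + ENNReal.ofReal (4 ^ |t + 1|) + ENNReal.ofReal (4 ^ |t + 2|)
  have hK : K ≠ ⊤ := by finiteness
  refine ⟨v⁻¹ * (8 * (3 * (4 * K))), by finiteness, fun f hf x => ?_⟩
  have hq := q_pos x
  have hs : 0 < √(q x) / 2 := by positivity
  have key := sq_mul_volume_ball_le hf x (√(q x) / 2)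
  rw [Measure.addHaar_ball_of_pos _ _ hs, finrank_euclideanSpace_fin, ← hv] at key
  have e1 : ENNReal.ofReal (q x ^ (t + 3 / 2) * f x ^ 2) =
      8 * (ENNReal.ofReal (q x ^ t) * (ENNReal.ofReal (f x ^ 2)
        * ENNReal.ofReal ((√(q x) / 2) ^ 3))) := by
    rw [← ENNReal.ofReal_mul (sq_nonneg _), ← ENNReal.ofReal_mul (q_rpow_pos t x).le,
      ← ENNReal.ofReal_ofNat 8, ← ENNReal.ofReal_mul (by norm_num)]
    congr 1
    rw [q_rpow_add, div_pow, Real.sqrt_eq_rpow, ← Real.rpow_natCast (q x ^ (1 / 2 : ℝ)),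
      ← Real.rpow_mul hq.le]
    norm_num
    ring
  have a0 := ofReal_q_rpow_mul_lintegral_ball_le t (fun z => f z ^ 2) x
  have a1 := ofReal_q_rpow_mul_lintegral_ball_le (t + 1) (gradSq f) x
  have a2 := ofReal_q_rpow_mul_lintegral_ball_le (t + 2) (hessSq f) x
  have hN := wNorm_two t hf
  have b0 : (∫⁻ z, ENNReal.ofReal (q z ^ t * f z ^ 2)) ≤ wNorm 2 t f := wL2_le_wNorm 2 t f
  have b1 : (∫⁻ z, ENNReal.ofReal (q z ^ (t + 1) * gradSq f z)) ≤ wNorm 2 t f := by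
    rw [hN]; exact le_add_self.trans le_self_add
  have b2 : (∫⁻ z, ENNReal.ofReal (q z ^ (t + 2) * hessSq f z)) ≤ wNorm 2 t f := by
    rw [hN]; exact le_add_self
  have r2 : (√(q x) / 2) ^ 2 ≤ q x := by
    rw [div_pow, Real.sq_sqrt hq.le]; linarith
  have r4 : (√(q x) / 2) ^ 4 ≤ q x ^ 2 := by
    calc (√(q x) / 2) ^ 4 = ((√(q x) / 2) ^ 2) ^ 2 := by ring
      _ ≤ _ := pow_le_pow_left₀ (sq_nonneg _) r2 2
  have c1 : ENNReal.ofReal (q x ^ t) * ENNReal.ofReal ((√(q x) / 2) ^ 2) ≤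
      ENNReal.ofReal (q x ^ (t + 1)) := by
    rw [← ENNReal.ofReal_mul (q_rpow_pos t x).le, q_rpow_add, Real.rpow_one]
    exact ENNReal.ofReal_le_ofReal (mul_le_mul_of_nonneg_left r2 (q_rpow_pos t x).le)
  have c2 : ENNReal.ofReal (q x ^ t) * ENNReal.ofReal ((√(q x) / 2) ^ 4) ≤
      ENNReal.ofReal (q x ^ (t + 2)) := by
    rw [← ENNReal.ofReal_mul (q_rpow_pos t x).le, q_rpow_add, Real.rpow_two]
    exact ENNReal.ofReal_le_ofReal (mul_le_mul_of_nonneg_left r4 (q_rpow_pos t x).le)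
  set N := wNorm 2 t f
  set A := ∫⁻ z in Metric.ball x (√(q x) / 2), ENNReal.ofReal (f z ^ 2)
  set B := ∫⁻ z in Metric.ball x (√(q x) / 2), ENNReal.ofReal (gradSq f z)
  set H := ∫⁻ z in Metric.ball x (√(q x) / 2), ENNReal.ofReal (hessSq f z)
  have main : ENNReal.ofReal (q x ^ (t + 3 / 2) * f x ^ 2) * v ≤ 8 * (3 * (4 * K)) * N := by
    calc ENNReal.ofReal (q x ^ (t + 3 / 2) * f x ^ 2) * v
        = 8 * (ENNReal.ofReal (q x ^ t) * (ENNReal.ofReal (f x ^ 2)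
          * (ENNReal.ofReal ((√(q x) / 2) ^ 3) * v))) := by rw [e1]; ring
      _ ≤ 8 * (ENNReal.ofReal (q x ^ t) * (3 * (A + ENNReal.ofReal ((√(q x) / 2) ^ 2) * B
          + 4 * ENNReal.ofReal ((√(q x) / 2) ^ 4) * H))) := by gcongr
      _ = 8 * (3 * (ENNReal.ofReal (q x ^ t) * A
          + ENNReal.ofReal (q x ^ t) * ENNReal.ofReal ((√(q x) / 2) ^ 2) * B
          + 4 * (ENNReal.ofReal (q x ^ t) * ENNReal.ofReal ((√(q x) / 2) ^ 4) * H))) := by ring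
      _ ≤ 8 * (3 * (ENNReal.ofReal (4 ^ |t|) * N + ENNReal.ofReal (4 ^ |t + 1|) * N
          + 4 * (ENNReal.ofReal (4 ^ |t + 2|) * N))) := by
          have d0 := a0.trans (mul_le_mul_right b0 _)
          have d1 := (mul_le_mul_left c1 B).trans (a1.trans (mul_le_mul_right b1 _))
          have d2 := (mul_le_mul_left c2 H).trans (a2.trans (mul_le_mul_right b2 _))
          exact mul_le_mul_right (mul_le_mul_right (add_le_add (add_le_add d0 d1)
            (mul_le_mul_right d2 4)) 3) 8
      _ ≤ 8 * (3 * (4 * (ENNReal.ofReal (4 ^ |t|) * N) + 4 * (ENNReal.ofReal (4 ^ |t + 1|) * N)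
          + 4 * (ENNReal.ofReal (4 ^ |t + 2|) * N))) := by
          have h4 : ∀ y : ENNReal, y ≤ 4 * y := fun y =>
            le_mul_of_one_le_left zero_le (by norm_num)
          exact mul_le_mul_right (mul_le_mul_right (add_le_add (add_le_add (h4 _) (h4 _))
            le_rfl) 3) 8
      _ = _ := by simp only [K]; ring
  calc ENNReal.ofReal (q x ^ (t + 3 / 2) * f x ^ 2)
      = v⁻¹ * (ENNReal.ofReal (q x ^ (t + 3 / 2) * f x ^ 2) * v) := by
        rw [mul_left_comm, ENNReal.inv_mul_cancel v0 vT, mul_one]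
    _ ≤ v⁻¹ * (8 * (3 * (4 * K)) * N) := mul_le_mul_right main _
    _ = _ := by ring

lemma pd_mul_fun {f g : E3 → ℝ} (hf : Smooth f) (hg : Smooth g) (i : Fin 3) :
    pd i (fun x => f x * g x) = fun x => pd i f x * g x + f x * pd i g x :=
  funext fun x => pd_mul hf hg i x

lemma wL2_mul_le (a b : ℝ) : ∃ C : ENNReal, C ≠ ⊤ ∧ ∀ f g, Smooth f → Smooth g →
    wL2 (a + b + 3 / 2) (fun x => f x * g x) ≤ C * (wNorm 2 a f * wL2 b g) := by
  obtain ⟨C, hC, h⟩ := sobolev_embedding a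
  refine ⟨C, hC, fun f g hf hg => ?_⟩
  rw [← mul_assoc]
  unfold wL2
  rw [← lintegral_const_mul _ (measurable_wL2_integrand b hg.continuous)]
  refine lintegral_mono fun x => ?_
  refine le_trans (le_of_eq ?_) (mul_le_mul_left (h f hf x) _)
  rw [← ENNReal.ofReal_mul (mul_nonneg (q_rpow_pos _ x).le (sq_nonneg _)),
    show a + b + 3 / 2 = (a + 3 / 2) + b by ring, q_rpow_add (a + 3 / 2) b]
  congr 1
  ring

/-- The multiplication property of the weighted Sobolev spaces. -/
lemma wNorm_mul_le (n : ℕ) (a b : ℝ) : ∃ C : ENNReal, C ≠ ⊤ ∧ ∀ f g, Smooth f → Smooth g →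
    wNorm n (a + b + 3 / 2) (fun x => f x * g x) ≤ C * (wNorm (n + 2) a f * wNorm n b g) := by
  induction n generalizing a b with
  | zero => exact wL2_mul_le a b
  | succ n ih =>
    obtain ⟨C0, hC0, h0⟩ := wL2_mul_le a b
    obtain ⟨C1, hC1, h1⟩ := ih (a + 1) b
    obtain ⟨C2, hC2, h2⟩ := ih a (b + 1)
    refine ⟨C0 + 3 * (2 * (C1 + C2)), by finiteness, fun f g hf hg => ?_⟩
    set N := wNorm (n + 1 + 2) a f * wNorm (n + 1) b g
    have k0 : wL2 (a + b + 3 / 2) (fun x => f x * g x) ≤ C0 * N :=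
      (h0 f g hf hg).trans (mul_le_mul_right (mul_le_mul' (wNorm_mono_order (by omega) a f)
        (wL2_le_wNorm _ b g)) _)
    have k : ∀ i, wNorm n (a + b + 3 / 2 + 1) (pd i fun x => f x * g x) ≤ 2 * (C1 + C2) * N := by
      intro i
      rw [pd_mul_fun hf hg]
      refine (wNorm_add_le n _ ((hf.pd i).mul hg) (hf.mul (hg.pd i))).trans ?_
      rw [mul_assoc, add_mul]
      refine mul_le_mul_right (add_le_add ?_ ?_) 2
      · rw [show a + b + 3 / 2 + 1 = a + 1 + b + 3 / 2 by ring]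
        exact (h1 _ _ (hf.pd i) hg).trans (mul_le_mul_right
          (mul_le_mul' (wNorm_pd_le (n + 2) a f i) (wNorm_le_succ n b g)) _)
      · rw [show a + b + 3 / 2 + 1 = a + (b + 1) + 3 / 2 by ring]
        exact (h2 _ _ hf (hg.pd i)).trans (mul_le_mul_right
          (mul_le_mul' (wNorm_le_succ (n + 2) a f) (wNorm_pd_le n b g i)) _)
    calc _ ≤ C0 * N + ∑ _i : Fin 3, 2 * (C1 + C2) * N :=
          add_le_add k0 (Finset.sum_le_sum fun i _ => k i)
      _ = _ := by
          rw [Finset.sum_const, Finset.card_univ, Fintype.card_fin, nsmul_eq_mul]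
          push_cast
          ring

section

variable {a : Fin 3 → Fin 3 → E3 → ℝ} {b : Fin 3 → E3 → ℝ} {c u : E3 → ℝ}

lemma pd_diffOp (ha : ∀ i j, Smooth (a i j)) (hb : ∀ i, Smooth (b i)) (hc : Smooth c)
    (hu : Smooth u) (k : Fin 3) :
    pd k (diffOp a b c u) = fun x => diffOp a b c (pd k u) x
      + diffOp (fun i j => pd k (a i j)) (fun i => pd k (b i)) (pd k c) u x := by
  have h2 : ∀ i j, Smooth fun x => a i j x * pd i (pd j u) x :=
    fun i j => (ha i j).mul ((hu.pd j).pd i)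
  have h1 : ∀ i, Smooth fun x => b i x * pd i u x := fun i => (hb i).mul (hu.pd i)
  have s2 : ∀ i, Smooth fun x => ∑ j, a i j x * pd i (pd j u) x :=
    fun i => Smooth.sum fun j _ => h2 i j
  have s2' : Smooth fun x => ∑ i, ∑ j, a i j x * pd i (pd j u) x := Smooth.sum fun i _ => s2 i
  have s1 : Smooth fun x => ∑ i, b i x * pd i u x := Smooth.sum fun i _ => h1 i
  have hcomm : ∀ j, pd k (pd j u) = pd j (pd k u) := fun j => funext fun x => pd_comm hu k j x
  funext x
  unfold diffOp
  rw [pd_add (s2'.add s1) (hc.mul hu), pd_add s2' s1, pd_sum (fun i _ => s2 i),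
    pd_sum (fun i _ => h1 i), pd_mul hc hu]
  simp_rw [pd_sum (fun j _ => h2 _ j), pd_mul (ha _ _) ((hu.pd _).pd _), pd_mul (hb _) (hu.pd _),
    pd_comm (hu.pd _) k, hcomm, Finset.sum_add_distrib]
  ring

lemma wNorm_diffOp_le {n : ℕ} {t : ℝ} {X : ENNReal} (ha : ∀ i j, Smooth (a i j))
    (hb : ∀ i, Smooth (b i)) (hc : Smooth c) (hu : Smooth u)
    (h2 : ∀ i j, wNorm n t (fun x => a i j x * pd i (pd j u) x) ≤ X)
    (h1 : ∀ i, wNorm n t (fun x => b i x * pd i u x) ≤ X)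
    (h0 : wNorm n t (fun x => c x * u x) ≤ X) :
    wNorm n t (diffOp a b c u) ≤ 626 * X := by
  have sum_le : ∀ {f : Fin 3 → E3 → ℝ} {Y : ENNReal}, (∀ i, Smooth (f i)) →
      (∀ i, wNorm n t (f i) ≤ Y) → wNorm n t (fun x => ∑ i, f i x) ≤ 12 * Y := by
    intro f Y hf hY
    refine (wNorm_sum_le n t hf).trans ?_
    refine (mul_le_mul_right (Finset.sum_le_sum fun i _ => hY i) 4).trans (le_of_eq ?_)
    rw [Finset.sum_const, Finset.card_univ, Fintype.card_fin, nsmul_eq_mul, ← mul_assoc]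
    norm_num
  have s2 : ∀ i j, Smooth fun x => a i j x * pd i (pd j u) x :=
    fun i j => (ha i j).mul ((hu.pd j).pd i)
  have s1 : ∀ i, Smooth fun x => b i x * pd i u x := fun i => (hb i).mul (hu.pd i)
  have s2' : ∀ i, Smooth fun x => ∑ j, a i j x * pd i (pd j u) x :=
    fun i => Smooth.sum fun j _ => s2 i j
  have t2 := sum_le s2' fun i => sum_le (s2 i) (h2 i)
  have t1 := sum_le s1 h1
  have k1 := wNorm_add_le n t (Smooth.sum (s := Finset.univ) fun i _ => s2' i)
    (Smooth.sum (s := Finset.univ) fun i _ => s1 i)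
  refine (wNorm_add_le n t ((Smooth.sum fun i _ => s2' i).add (Smooth.sum fun i _ => s1 i))
    (hc.mul hu)).trans ?_
  refine (mul_le_mul_right (add_le_add (k1.trans
    (mul_le_mul_right (add_le_add t2 t1) 2)) h0) 2).trans (le_of_eq ?_)
  ring

/-- Weighted Sobolev bounds for the coefficients, measuring the distance to the Laplacian. -/
structure CoefBound (m : ℕ) (d : ℝ) (K : ENNReal) (a : Fin 3 → Fin 3 → E3 → ℝ)
    (b : Fin 3 → E3 → ℝ) (c : E3 → ℝ) : Prop where
  smooth_a : ∀ i j, Smooth (a i j)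
  smooth_b : ∀ i, Smooth (b i)
  smooth_c : Smooth c
  norm_a : ∀ i j, wNorm (m + 3) d (fun x => a i j x - if i = j then 1 else 0) ≤ K
  norm_b : ∀ i, wNorm (m + 2) (d + 1) (b i) ≤ K
  norm_c : wNorm (m + 1) (d + 2) c ≤ K

lemma pd_sub_const_fun (f : E3 → ℝ) (c : ℝ) (i : Fin 3) : pd i (fun x => f x - c) = pd i f :=
  funext fun x => pd_sub_const f c i x

lemma CoefBound.norm_da {m : ℕ} {d : ℝ} {K : ENNReal} (h : CoefBound m d K a b c) (i j k : Fin 3) :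
    wNorm (m + 2) (d + 1) (pd k (a i j)) ≤ K := by
  rw [← pd_sub_const_fun (a i j) (if i = j then 1 else 0)]
  exact (wNorm_pd_le (m + 2) d _ k).trans (h.norm_a i j)

end

/-- Estimate for the commutator of a partial derivative with the operator. -/
lemma commutator_le {m : ℕ} {d : ℝ} (hd : -(3 / 2) < d) {K : ENNReal} (hK : K ≠ ⊤) (n : ℕ)
    (hn : n + 1 ≤ m) (τ : ℝ) : ∃ C : ENNReal, C ≠ ⊤ ∧ ∀ a b c, CoefBound m d K a b c →
    ∀ u, Smooth u → ∀ k : Fin 3,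
      wNorm n (τ + 3) (diffOp (fun i j => pd k (a i j)) (fun i => pd k (b i)) (pd k c) u)
        ≤ C * wNorm (n + 2) τ u := by
  obtain ⟨C2, hC2, h2⟩ := wNorm_mul_le n (d + 1) (τ + 2)
  obtain ⟨C1, hC1, h1⟩ := wNorm_mul_le n (d + 2) (τ + 1)
  obtain ⟨C0, hC0, h0⟩ := wNorm_mul_le n τ (d + 3)
  refine ⟨626 * ((C2 + C1 + C0) * K), by finiteness, fun a b c hc u hu k => ?_⟩
  rw [mul_assoc]
  refine wNorm_diffOp_le (fun i j => (hc.smooth_a i j).pd k) (fun i => (hc.smooth_b i).pd k)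
    (hc.smooth_c.pd k) hu (fun i j => ?_) (fun i => ?_) ?_
  · refine (wNorm_mono_weight n (by linarith : τ + 3 ≤ d + 1 + (τ + 2) + 3 / 2) _).trans ?_
    refine (h2 _ _ ((hc.smooth_a i j).pd k) ((hu.pd j).pd i)).trans ?_
    rw [mul_assoc]
    refine mul_le_mul' (le_self_add.trans le_self_add) (mul_le_mul' ?_ ?_)
    · exact (wNorm_mono_order (by omega) _ _).trans (hc.norm_da i j k)
    · rw [show τ + 2 = τ + 1 + 1 by ring]
      exact (wNorm_pd_le n _ _ i).trans (wNorm_pd_le (n + 1) _ _ j)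
  · refine (wNorm_mono_weight n (by linarith : τ + 3 ≤ d + 2 + (τ + 1) + 3 / 2) _).trans ?_
    refine (h1 _ _ ((hc.smooth_b i).pd k) (hu.pd i)).trans ?_
    rw [mul_assoc]
    refine mul_le_mul' (le_add_self.trans le_self_add) (mul_le_mul' ?_ ?_)
    · rw [show d + 2 = d + 1 + 1 by ring]
      exact (wNorm_mono_order (by omega) _ _).trans
        ((wNorm_pd_le (m + 1) _ _ k).trans (hc.norm_b i))
    · exact (wNorm_pd_le n _ _ i).trans (wNorm_le_succ _ _ _)
  · refine (wNorm_mono_weight n (by linarith : τ + 3 ≤ τ + (d + 3) + 3 / 2) _).trans ?_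
    simp_rw [mul_comm (pd k c _)]
    refine (h0 _ _ hu (hc.smooth_c.pd k)).trans ?_
    rw [mul_assoc, mul_comm (wNorm (n + 2) τ u)]
    refine mul_le_mul' le_add_self (mul_le_mul' ?_ le_rfl)
    rw [show d + 3 = d + 2 + 1 by ring]
    exact (wNorm_pd_le n _ _ k).trans ((wNorm_mono_order (by omega) _ _).trans hc.norm_c)

lemma l2w_of_wL2_lt_top {t : ℝ} {f : E3 → ℝ} (hf : Continuous f) (h : wL2 t f < ⊤) : L2w t f :=
  (lintegral_ofReal_ne_top_iff_integrable
    ((smooth_q_rpow t).continuous.mul (hf.pow 2)).aestronglyMeasurable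
    (Filter.Eventually.of_forall fun x => mul_nonneg (q_rpow_pos t x).le (sq_nonneg _))).1 h.ne

lemma L2w.wL2_eq {t : ℝ} {f : E3 → ℝ} (h : L2w t f) :
    wL2 t f = ENNReal.ofReal (∫ x, q x ^ t * f x ^ 2) :=
  (ofReal_integral_eq_lintegral_ofReal h
    (Filter.Eventually.of_forall fun x => mul_nonneg (q_rpow_pos t x).le (sq_nonneg _))).symm

lemma h2w_of_wNorm_lt_top {τ : ℝ} {u : E3 → ℝ} (hu : Smooth u) (h : wNorm 2 τ u < ⊤) :
    H2w τ u where
  zero := l2w_of_wL2_lt_top hu.continuous ((wL2_le_wNorm 2 τ u).trans_lt h)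
  one i := l2w_of_wL2_lt_top (hu.pd i).continuous
    (((wL2_le_wNorm 1 _ _).trans (wNorm_pd_le 1 τ u i)).trans_lt h)
  two i j := l2w_of_wL2_lt_top ((hu.pd j).pd i).continuous (by
    rw [show τ + 2 = τ + 1 + 1 by ring]
    exact ((wNorm_pd_le 0 _ _ i).trans (wNorm_pd_le 1 τ u j)).trans_lt h)

lemma H2w.wNorm_two_eq {τ : ℝ} {u : E3 → ℝ} (hu : Smooth u) (h : H2w τ u) :
    wNorm 2 τ u = wL2 τ u + (ENNReal.ofReal ((∫ x, q x ^ (τ + 1) * gradSq u x)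
      + ∫ x, q x ^ (τ + 2) * hessSq u x)) := by
  have hg : ∀ x, 0 ≤ q x ^ (τ + 1) * gradSq u x := fun x =>
    mul_nonneg (q_rpow_pos _ x).le (gradSq_nonneg u x)
  have hh : ∀ x, 0 ≤ q x ^ (τ + 2) * hessSq u x := fun x =>
    mul_nonneg (q_rpow_pos _ x).le (hessSq_nonneg u x)
  rw [wNorm_two τ hu, ENNReal.ofReal_add (integral_nonneg hg) (integral_nonneg hh),
    ofReal_integral_eq_lintegral_ofReal (integrable_gradSq h.one) (Filter.Eventually.of_forall hg),
    ofReal_integral_eq_lintegral_ofReal (integrable_hessSq h.two) (Filter.Eventually.of_forall hh),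
    add_assoc]

lemma wNorm_two_le {ε lam K : ℝ} (τ : ℝ) (hε : 0 ≤ ε) (hlam : 0 < lam) (hK : 0 ≤ K) :
    ∃ C : ENNReal, C ≠ ⊤ ∧ ∀ a b c, DecayBound ε lam K a b c → ∀ u, Smooth u →
      wNorm 2 τ u < ⊤ → wNorm 2 τ u ≤ C * (wL2 (τ + 2) (diffOp a b c u) + wL2 τ u) := by
  obtain ⟨C, hC, h⟩ := second_order_regularity τ hε hlam hK
  refine ⟨ENNReal.ofReal C + 1, by finiteness, fun a b c hD u hu hN => ?_⟩
  have hH := h2w_of_wNorm_lt_top hu hN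
  have hL := hD.l2w_diffOp hε hu hH
  have k := ENNReal.ofReal_le_ofReal (h a b c hD u hu hH)
  rw [ENNReal.ofReal_mul hC, ENNReal.ofReal_add
    (integral_nonneg fun x => mul_nonneg (q_rpow_pos _ x).le (sq_nonneg _))
    (integral_nonneg fun x => mul_nonneg (q_rpow_pos _ x).le (sq_nonneg _)),
    ← hL.wL2_eq, ← hH.zero.wL2_eq] at k
  rw [hH.wNorm_two_eq hu, add_mul, one_mul, add_comm]
  exact add_le_add k le_add_self

lemma wL2_le_diffOp_add_ball {ε lam K τ : ℝ} (hε : 0 < ε) (hε' : 2 * ε ≤ 1) (hlam : 0 < lam)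
    (hK : 0 ≤ K) (hτ : -(5 / 2) < τ) (hτ' : τ < -(3 / 2)) :
    ∃ (C : ENNReal) (r : ℝ), C ≠ ⊤ ∧ 0 < r ∧ ∀ a b c, DecayBound ε lam K a b c → ∀ u, Smooth u →
      wNorm 2 τ u < ⊤ → wL2 τ u ≤ C * (wL2 (τ + 2) (diffOp a b c u)
        + ∫⁻ x in Metric.ball 0 r, ENNReal.ofReal (u x ^ 2)) := by
  obtain ⟨C, r, hC, hr, h⟩ := l2_le_diffOp_add_ball hε hε' hlam hK hτ hτ'
  refine ⟨ENNReal.ofReal C, r, by finiteness, hr, fun a b c hD u hu hN => ?_⟩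
  have hH := h2w_of_wNorm_lt_top hu hN
  have hL := hD.l2w_diffOp hε.le hu hH
  have hB : IntegrableOn (fun x => u x ^ 2) (Metric.ball 0 r) :=
    ((hu.continuous.pow 2).continuousOn.integrableOn_compact
      (isCompact_closedBall (0 : E3) r)).mono_set Metric.ball_subset_closedBall
  have k := ENNReal.ofReal_le_ofReal (h a b c hD u hu hH)
  rwa [ENNReal.ofReal_mul hC, ENNReal.ofReal_add
    (integral_nonneg fun x => mul_nonneg (q_rpow_pos _ x).le (sq_nonneg _))
    (integral_nonneg fun x => sq_nonneg _), ← hL.wL2_eq, ← hH.zero.wL2_eq,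
    ofReal_integral_eq_lintegral_ofReal hB
      (Filter.Eventually.of_forall fun x => sq_nonneg (u x))] at k

lemma abs_le_of_wNorm_two_le (t : ℝ) {K : ENNReal} (hK : K ≠ ⊤) : ∃ B : ℝ, 0 ≤ B ∧ ∀ f, Smooth f →
    wNorm 2 t f ≤ K → ∀ x, |f x| ≤ B * q x ^ (-((t + 3 / 2) / 2)) := by
  obtain ⟨C, hC, h⟩ := sobolev_embedding t
  refine ⟨√(C * K).toReal, Real.sqrt_nonneg _, fun f hf hN x => ?_⟩
  have k := (h f hf x).trans (mul_le_mul_right hN C)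
  rw [← ENNReal.ofReal_toReal (ENNReal.mul_ne_top hC hK),
    ENNReal.ofReal_le_ofReal_iff ENNReal.toReal_nonneg] at k
  have p := q_rpow_pos ((t + 3 / 2) / 2) x
  rw [← q_rpow_half_sq, ← mul_pow] at k
  have k2 := Real.abs_le_sqrt k
  rw [abs_mul, abs_of_pos p] at k2
  rw [Real.rpow_neg (q_pos x).le, ← div_eq_mul_inv, le_div_iff₀ p, mul_comm]
  exact k2

lemma CoefBound.decayBound {m : ℕ} (hm : 1 ≤ m) {d ε : ℝ} (hd : -(3 / 2) < d)
    (hε : ε ≤ (d + 3 / 2) / 2) (lam : ℝ) {K : ENNReal} (hK : K ≠ ⊤) :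
    ∃ B : ℝ, 0 ≤ B ∧ ∀ a b c, CoefBound m d K a b c →
      (∀ x (ξ : Fin 3 → ℝ), lam * ∑ i, ξ i ^ 2 ≤ ∑ i, ∑ j, a i j x * ξ i * ξ j) →
      DecayBound ε lam B a b c := by
  obtain ⟨B0, hB0, h0⟩ := abs_le_of_wNorm_two_le d hK
  obtain ⟨B1, hB1, h1⟩ := abs_le_of_wNorm_two_le (d + 1) hK
  obtain ⟨B2, hB2, h2⟩ := abs_le_of_wNorm_two_le (d + 2) hK
  refine ⟨B0 + B1 + B2, by positivity, fun a b c hc hell => ⟨hc.smooth_a, hc.smooth_b, hc.smooth_c,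
    hell, fun i j x => ?_, fun i j l x => ?_, fun i x => ?_, fun x => ?_⟩⟩
  · refine (h0 _ ((hc.smooth_a i j).sub contDiff_const)
      ((wNorm_mono_order (by omega) _ _).trans (hc.norm_a i j)) x).trans ?_
    exact mul_le_mul (by linarith) (q_rpow_mono (by linarith) x) (q_rpow_pos _ x).le (by positivity)
  · refine (h1 _ ((hc.smooth_a i j).pd l)
      ((wNorm_mono_order (by omega) _ _).trans (hc.norm_da i j l)) x).trans ?_
    exact mul_le_mul (by linarith) (q_rpow_mono (by linarith) x) (q_rpow_pos _ x).le (by positivity)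
  · refine (h1 _ (hc.smooth_b i)
      ((wNorm_mono_order (by omega) _ _).trans (hc.norm_b i)) x).trans ?_
    exact mul_le_mul (by linarith) (q_rpow_mono (by linarith) x) (q_rpow_pos _ x).le (by positivity)
  · refine (h2 _ hc.smooth_c
      ((wNorm_mono_order (by omega) _ _).trans hc.norm_c) x).trans ?_
    exact mul_le_mul (by linarith) (q_rpow_mono (by linarith) x) (q_rpow_pos _ x).le (by positivity)

/-- Weighted elliptic regularity, for functions with finite norm. -/
lemma elliptic_regularity {m : ℕ} {d : ℝ} (hd : -(3 / 2) < d) {K : ENNReal} (hK : K ≠ ⊤)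
    {ε lam B : ℝ} (hε : 0 ≤ ε) (hlam : 0 < lam) (hB : 0 ≤ B) (n : ℕ) (hn : n ≤ m) (τ : ℝ) :
    ∃ C : ENNReal, C ≠ ⊤ ∧ ∀ a b c, CoefBound m d K a b c → DecayBound ε lam B a b c →
      ∀ u, Smooth u → wNorm (n + 2) τ u < ⊤ →
        wNorm (n + 2) τ u ≤ C * (wNorm n (τ + 2) (diffOp a b c u) + wL2 τ u) := by
  induction n generalizing τ with
  | zero =>
    obtain ⟨C, hC, h⟩ := wNorm_two_le τ hε hlam hB
    exact ⟨C, hC, fun a b c _ hD u hu hN => h a b c hD u hu hN⟩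
  | succ n ih =>
    obtain ⟨C0, hC0, h0⟩ := ih (by omega) τ
    obtain ⟨C1, hC1, h1⟩ := ih (by omega) (τ + 1)
    obtain ⟨C2, hC2, h2⟩ := commutator_le hd hK n hn τ
    refine ⟨1 + 3 * (C1 * (2 * (1 + C2 * C0) + C0)), by finiteness, fun a b c hc hD u hu hN => ?_⟩
    set F := wNorm (n + 1) (τ + 2) (diffOp a b c u)
    set U := wL2 τ u
    have hN' : wNorm (n + 2) τ u ≤ C0 * (F + U) :=
      (h0 a b c hc hD u hu ((wNorm_le_succ _ _ _).trans_lt hN)).trans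
        (mul_le_mul_right (add_le_add (wNorm_le_succ _ _ _) le_rfl) _)
    have hL : Smooth (diffOp a b c u) := smooth_diffOp hc.smooth_a hc.smooth_b hc.smooth_c hu
    have hk : ∀ k, wNorm (n + 2) (τ + 1) (pd k u) ≤ C1 * (2 * (1 + C2 * C0) + C0) * (F + U) := by
      intro k
      have hcomm : Smooth (diffOp (fun i j => pd k (a i j)) (fun i => pd k (b i)) (pd k c) u) :=
        smooth_diffOp (fun i j => (hc.smooth_a i j).pd k) (fun i => (hc.smooth_b i).pd k)
          (hc.smooth_c.pd k) hu
      have e : diffOp a b c (pd k u) = fun x => pd k (diffOp a b c u) x +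
          -diffOp (fun i j => pd k (a i j)) (fun i => pd k (b i)) (pd k c) u x := by
        rw [pd_diffOp hc.smooth_a hc.smooth_b hc.smooth_c hu k]
        funext x
        ring
      refine (h1 a b c hc hD (pd k u) (hu.pd k)
        ((wNorm_pd_le (n + 2) τ u k).trans_lt hN)).trans ?_
      rw [mul_assoc, e, add_mul]
      refine mul_le_mul_right (add_le_add ?_ ?_) _
      · refine (wNorm_add_le n _ (hL.pd k) hcomm.neg).trans ?_
        rw [mul_assoc, wNorm_neg, add_mul, one_mul]
        refine mul_le_mul_right (add_le_add ?_ ?_) 2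
        · rw [show τ + 1 + 2 = τ + 2 + 1 by ring]
          exact (wNorm_pd_le n _ _ k).trans le_self_add
        · rw [show τ + 1 + 2 = τ + 3 by ring, mul_assoc]
          exact (h2 a b c hc u hu k).trans (mul_le_mul_right hN' _)
      · exact (wL2_le_wNorm (n + 1) _ _).trans ((wNorm_pd_le (n + 1) τ u k).trans hN')
    calc wNorm (n + 1 + 2) τ u ≤ (F + U) +
          ∑ _k : Fin 3, C1 * (2 * (1 + C2 * C0) + C0) * (F + U) :=
          add_le_add le_add_self (Finset.sum_le_sum fun k _ => hk k)
      _ = _ := by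
          rw [Finset.sum_const, Finset.card_univ, Fintype.card_fin, nsmul_eq_mul]
          push_cast
          ring

/-- The squared weighted `L²` norm of the `k`-th derivative. -/
noncomputable def wDeriv (k : ℕ) (t : ℝ) (f : E3 → ℝ) : ENNReal :=
  ∫⁻ x, ENNReal.ofReal (q x ^ t * ‖iteratedFDeriv ℝ k f x‖ ^ 2)

lemma wSob_eq (s : ℕ) (t : ℝ) (f : E3 → ℝ) :
    wSob s t f = (∑ k ∈ Finset.range (s + 1), wDeriv k (t + k) f) ^ (1 / 2 : ℝ) := rfl

lemma wDeriv_zero (t : ℝ) (f : E3 → ℝ) : wDeriv 0 t f = wL2 t f := by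
  simp [wDeriv, wL2]

lemma norm_iteratedFDeriv_pd_le {f : E3 → ℝ} (hf : Smooth f) (k : ℕ) (i : Fin 3) (x : E3) :
    ‖iteratedFDeriv ℝ k (pd i f) x‖ ≤ ‖iteratedFDeriv ℝ (k + 1) f x‖ := by
  have hd : ContDiffAt ℝ (⊤ : ℕ∞) (fderiv ℝ f) x :=
    (hf.fderiv_right (m := (⊤ : ℕ∞)) (by simp)).contDiffAt
  have h := (ContinuousLinearMap.apply ℝ ℝ (EuclideanSpace.single i (1 : ℝ))
    : (E3 →L[ℝ] ℝ) →L[ℝ] ℝ).norm_iteratedFDeriv_comp_left hd (n := k) (by exact_mod_cast le_top)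
  rw [norm_iteratedFDeriv_fderiv] at h
  refine h.trans (mul_le_of_le_one_left (norm_nonneg _) ?_)
  refine ContinuousLinearMap.opNorm_le_bound _ zero_le_one fun v => ?_
  simpa using v.le_opNorm (EuclideanSpace.single i (1 : ℝ))

lemma fderiv_eq_sum_smul_proj (f : E3 → ℝ) :
    fderiv ℝ f = fun x => ∑ i, pd i f x • (EuclideanSpace.proj i : E3 →L[ℝ] ℝ) := by
  funext x
  ext y
  rw [fderiv_apply_eq_sum_pd]
  simp [mul_comm]

lemma norm_iteratedFDeriv_succ_le {f : E3 → ℝ} (hf : Smooth f) (k : ℕ) (x : E3) :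
    ‖iteratedFDeriv ℝ (k + 1) f x‖ ≤ ∑ i, ‖iteratedFDeriv ℝ k (pd i f) x‖ := by
  rw [← norm_iteratedFDeriv_fderiv, fderiv_eq_sum_smul_proj]
  set L : Fin 3 → ℝ →L[ℝ] (E3 →L[ℝ] ℝ) := fun i =>
    ContinuousLinearMap.toSpanSingleton ℝ (EuclideanSpace.proj i : E3 →L[ℝ] ℝ)
  have e : (fun x => ∑ i, pd i f x • (EuclideanSpace.proj i : E3 →L[ℝ] ℝ)) =
      fun x => ∑ i, (L i ∘ pd i f) x := rfl
  have hs : ∀ i, ContDiff ℝ k (pd i f) := fun i => (hf.pd i).of_le (by exact_mod_cast le_top)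
  rw [e, iteratedFDeriv_fun_sum_apply fun i _ => ((L i).contDiff.comp (hs i)).contDiffAt]
  refine (norm_sum_le _ _).trans (Finset.sum_le_sum fun i _ => ?_)
  refine ((L i).norm_iteratedFDeriv_comp_left (hs i).contDiffAt le_rfl).trans
    (mul_le_of_le_one_left (norm_nonneg _) ?_)
  rw [ContinuousLinearMap.norm_toSpanSingleton]
  refine ContinuousLinearMap.opNorm_le_bound _ zero_le_one fun v => ?_
  simpa using PiLp.norm_apply_le v i

lemma wDeriv_pd_le (k : ℕ) (t : ℝ) {f : E3 → ℝ} (hf : Smooth f) (i : Fin 3) :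
    wDeriv k t (pd i f) ≤ wDeriv (k + 1) t f :=
  lintegral_mono fun x => ENNReal.ofReal_le_ofReal (mul_le_mul_of_nonneg_left
    (pow_le_pow_left₀ (norm_nonneg _) (norm_iteratedFDeriv_pd_le hf k i x) 2) (q_rpow_pos t x).le)

lemma wDeriv_succ_le (k : ℕ) (t : ℝ) {f : E3 → ℝ} (hf : Smooth f) :
    wDeriv (k + 1) t f ≤ 3 * ∑ i, wDeriv k t (pd i f) := by
  unfold wDeriv
  rw [← lintegral_finsetSum _ (fun i _ => Measurable.ennreal_ofReal (Continuous.measurable ?_)),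
    ← lintegral_const_mul' _ _ (by simp)]
  · refine lintegral_mono fun x => ?_
    have h1 := pow_le_pow_left₀ (norm_nonneg _) (norm_iteratedFDeriv_succ_le hf k x) 2
    have h2 := h1.trans sq_sum_le_card_mul_sum_sq
    rw [← ENNReal.ofReal_sum_of_nonneg fun i _ => mul_nonneg (q_rpow_pos t x).le (sq_nonneg _),
      ← Finset.mul_sum]
    refine (ENNReal.ofReal_le_ofReal (mul_le_mul_of_nonneg_left h2 (q_rpow_pos t x).le)).trans
      (le_of_eq ?_)
    rw [← ENNReal.ofReal_ofNat 3, ← ENNReal.ofReal_mul (by norm_num)]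
    congr 1
    simp only [Finset.card_univ, Fintype.card_fin]
    push_cast
    ring
  · exact (smooth_q_rpow t).continuous.mul
      (((hf.pd i).continuous_iteratedFDeriv (m := k) (by exact_mod_cast le_top)).norm.pow 2)

lemma sum_wDeriv_succ (s : ℕ) (t : ℝ) (f : E3 → ℝ) :
    ∑ k ∈ Finset.range (s + 1 + 1), wDeriv k (t + k) f =
      wL2 t f + ∑ k ∈ Finset.range (s + 1), wDeriv (k + 1) (t + 1 + k) f := by
  rw [Finset.sum_range_succ', add_comm, ← wDeriv_zero]
  simp only [Nat.cast_add, Nat.cast_one, Nat.cast_zero, add_zero, add_assoc, add_comm (1 : ℝ)]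

lemma wNorm_le_sum_wDeriv (s : ℕ) (t : ℝ) {f : E3 → ℝ} (hf : Smooth f) :
    wNorm s t f ≤ 4 ^ s * ∑ k ∈ Finset.range (s + 1), wDeriv k (t + k) f := by
  induction s generalizing t f with
  | zero => simp [wNorm_zero, wDeriv_zero]
  | succ s ih =>
    rw [sum_wDeriv_succ, wNorm_succ]
    set R := ∑ k ∈ Finset.range (s + 1), wDeriv (k + 1) (t + 1 + k) f
    have h : ∀ i, wNorm s (t + 1) (pd i f) ≤ 4 ^ s * R := fun i => (ih (t + 1) (hf.pd i)).trans
      (mul_le_mul_right (Finset.sum_le_sum fun k _ => wDeriv_pd_le k _ hf i) _)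
    calc wL2 t f + ∑ i, wNorm s (t + 1) (pd i f)
        ≤ 4 ^ (s + 1) * wL2 t f + 4 ^ (s + 1) * R := by
          refine add_le_add (le_mul_of_one_le_left zero_le (one_le_pow₀ (by norm_num))) ?_
          refine (Finset.sum_le_card_nsmul _ _ _ fun i _ => h i).trans ?_
          rw [Finset.card_univ, Fintype.card_fin, nsmul_eq_mul, pow_succ', mul_assoc]
          exact mul_le_mul_left (by norm_num) _
      _ = _ := (mul_add _ _ _).symm

lemma sum_wDeriv_le_wNorm (s : ℕ) (t : ℝ) {f : E3 → ℝ} (hf : Smooth f) :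
    ∑ k ∈ Finset.range (s + 1), wDeriv k (t + k) f ≤ 4 ^ s * wNorm s t f := by
  induction s generalizing t f with
  | zero => simp [wNorm_zero, wDeriv_zero]
  | succ s ih =>
    rw [sum_wDeriv_succ, wNorm_succ, mul_add]
    refine add_le_add (le_mul_of_one_le_left zero_le (one_le_pow₀ (by norm_num))) ?_
    calc ∑ k ∈ Finset.range (s + 1), wDeriv (k + 1) (t + 1 + k) f
        ≤ ∑ k ∈ Finset.range (s + 1), 3 * ∑ i, wDeriv k (t + 1 + k) (pd i f) :=
          Finset.sum_le_sum fun k _ => wDeriv_succ_le k _ hf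
      _ = 3 * ∑ i, ∑ k ∈ Finset.range (s + 1), wDeriv k (t + 1 + k) (pd i f) := by
          rw [← Finset.mul_sum, Finset.sum_comm]
      _ ≤ 4 * ∑ i, 4 ^ s * wNorm s (t + 1) (pd i f) :=
          mul_le_mul' (by norm_num) (Finset.sum_le_sum fun i _ => ih (t + 1) (hf.pd i))
      _ = _ := by rw [← Finset.mul_sum, pow_succ', mul_assoc]

lemma sq_rpow_half (X : ENNReal) : (X ^ (1 / 2 : ℝ)) ^ 2 = X := by
  rw [← ENNReal.rpow_natCast, ← ENNReal.rpow_mul]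
  norm_num

lemma wNorm_le_wSob_sq (s : ℕ) (t : ℝ) {f : E3 → ℝ} (hf : Smooth f) :
    wNorm s t f ≤ 4 ^ s * wSob s t f ^ 2 := by
  rw [wSob_eq, sq_rpow_half]
  exact wNorm_le_sum_wDeriv s t hf

lemma wSob_sq_le_wNorm (s : ℕ) (t : ℝ) {f : E3 → ℝ} (hf : Smooth f) :
    wSob s t f ^ 2 ≤ 4 ^ s * wNorm s t f := by
  rw [wSob_eq, sq_rpow_half]
  exact sum_wDeriv_le_wNorm s t hf

lemma lintegral_ball_sq_le_sobBall_sq (s : ℕ) (r : ℝ) (f : E3 → ℝ) :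
    ∫⁻ x in Metric.ball 0 r, ENNReal.ofReal (f x ^ 2) ≤ sobBall s r f ^ 2 := by
  rw [sobBall, sq_rpow_half]
  refine le_trans (le_of_eq ?_) (Finset.single_le_sum (f := fun k =>
    ∫⁻ x in Metric.ball (0 : E3) r, ENNReal.ofReal (‖iteratedFDeriv ℝ k f x‖ ^ 2))
    (fun _ _ => zero_le) (Finset.mem_range.2 s.succ_pos))
  simp

/-- The weighted a priori estimate, in terms of squared norms. -/
lemma wNorm_le_diffOp_add_ball {m n : ℕ} (hm : 1 ≤ m) (hn : n ≤ m) {d : ℝ} (hd : -(3 / 2) < d)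
    {K : ENNReal} (hK : K ≠ ⊤) {lam : ℝ} (hlam : 0 < lam) {τ : ℝ} (hτ : -(5 / 2) < τ)
    (hτ' : τ < -(3 / 2)) :
    ∃ (C : ENNReal) (r : ℝ), C ≠ ⊤ ∧ 0 < r ∧ ∀ a b c, CoefBound m d K a b c →
      (∀ x (ξ : Fin 3 → ℝ), lam * ∑ i, ξ i ^ 2 ≤ ∑ i, ∑ j, a i j x * ξ i * ξ j) →
      ∀ u, Smooth u → wNorm (n + 2) τ u < ⊤ →
        wNorm (n + 2) τ u ≤ C * (wNorm n (τ + 2) (diffOp a b c u)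
          + ∫⁻ x in Metric.ball 0 r, ENNReal.ofReal (u x ^ 2)) := by
  obtain ⟨ε, hε, hε1, hε2⟩ : ∃ ε : ℝ, 0 < ε ∧ 2 * ε ≤ 1 ∧ ε ≤ (d + 3 / 2) / 2 :=
    ⟨min ((d + 3 / 2) / 2) (1 / 2), lt_min (by linarith) (by norm_num),
      by linarith [min_le_right ((d + 3 / 2) / 2) (1 / 2)], min_le_left _ _⟩
  obtain ⟨B, hB, hDB⟩ := CoefBound.decayBound hm hd hε2 lam hK
  obtain ⟨C1, hC1, h1⟩ := elliptic_regularity hd hK hε.le hlam hB n hn τ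
  obtain ⟨C2, r, hC2, hr, h2⟩ := wL2_le_diffOp_add_ball hε hε1 hlam hB hτ hτ'
  refine ⟨C1 * (1 + C2), r, by finiteness, hr, fun a b c hc hell u hu hN => ?_⟩
  have hD := hDB a b c hc hell
  refine (h1 a b c hc hD u hu hN).trans ?_
  rw [mul_assoc, add_mul, one_mul]
  refine mul_le_mul_right (add_le_add le_self_add ?_) C1
  exact (h2 a b c hD u hu ((wNorm_mono_order (by omega) τ u).trans_lt hN)).trans
    (mul_le_mul_right (add_le_add (wL2_le_wNorm n _ _) le_rfl) C2)

lemma le_rpow_half_mul_add {X Y Z D : ENNReal} (h : X ^ 2 ≤ D * (Y ^ 2 + Z ^ 2)) :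
    X ≤ D ^ (1 / 2 : ℝ) * (Y + Z) := by
  refine (ENNReal.pow_le_pow_left_iff two_ne_zero).1 (h.trans ?_)
  rw [mul_pow, sq_rpow_half]
  refine mul_le_mul_right ?_ D
  rw [show (Y + Z) ^ 2 = Y ^ 2 + Z ^ 2 + 2 * Y * Z by ring]
  exact le_self_add

end WeightedSobolev

/-- **Weighted a priori estimate for elliptic operators asymptotic to the Laplacian on
`ℝ³`**: for `s₀ ≥ 4`, `δ₀ > −3/2`, `λ > 0`, `M > 0`, `2 ≤ s ≤ s₀`, `−3/2 < δ < −1/2`, there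
are `C > 0` and `r > 0`, depending only on these data, such that for all smooth coefficients
`a₂, a₁, a₀` satisfying the stated ellipticity and weighted norm bounds, and all smooth `u`
with finite `H_{s,δ−1}(ℝ³)`-norm,
`‖u‖_{H_{s,δ−1}} ≤ C(‖Lu‖_{H_{s−2,δ+1}} + ‖u‖_{H_{s−2}(B_{2r})})`. -/
theorem weighted_elliptic_estimate
    (s₀ : ℕ) (hs₀ : 4 ≤ s₀) (δ₀ : ℝ) (hδ₀ : -(3:ℝ)/2 < δ₀)
    (lam M : ℝ) (hlam : 0 < lam) (hM : 0 < M)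
    (s : ℕ) (hs₁ : 2 ≤ s) (hs₂ : s ≤ s₀)
    (δ : ℝ) (hδ₁ : -(3:ℝ)/2 < δ) (hδ₂ : δ < -(1:ℝ)/2) :
    ∃ C r : ℝ, 0 < C ∧ 0 < r ∧
      ∀ (a₂ : EuclideanSpace ℝ (Fin 3) → Matrix (Fin 3) (Fin 3) ℝ)
        (a₁ : EuclideanSpace ℝ (Fin 3) → Fin 3 → ℝ)
        (a₀ : EuclideanSpace ℝ (Fin 3) → ℝ),
        (∀ i j : Fin 3, ContDiff ℝ (⊤ : ℕ∞) (fun x => a₂ x i j)) →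
        (∀ i : Fin 3, ContDiff ℝ (⊤ : ℕ∞) (fun x => a₁ x i)) →
        ContDiff ℝ (⊤ : ℕ∞) a₀ →
        (∀ x, (a₂ x).IsSymm) →
        (∀ (x : EuclideanSpace ℝ (Fin 3)) (ξ : EuclideanSpace ℝ (Fin 3)),
          lam * ‖ξ‖ ^ 2 ≤ ∑ i : Fin 3, ∑ j : Fin 3, a₂ x i j * ξ i * ξ j ∧
          ∑ i : Fin 3, ∑ j : Fin 3, a₂ x i j * ξ i * ξ j ≤ lam⁻¹ * ‖ξ‖ ^ 2) →
        (∀ i j : Fin 3,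
          wSob (s₀ + 1) δ₀ (fun x => a₂ x i j - (if i = j then (1:ℝ) else 0))
            ≤ ENNReal.ofReal M) →
        (∀ i : Fin 3, wSob s₀ (δ₀ + 1) (fun x => a₁ x i) ≤ ENNReal.ofReal M) →
        wSob (s₀ - 1) (δ₀ + 2) a₀ ≤ ENNReal.ofReal M →
        ∀ u : EuclideanSpace ℝ (Fin 3) → ℝ, ContDiff ℝ (⊤ : ℕ∞) u →
          wSob s (δ - 1) u < ⊤ →
          wSob s (δ - 1) u
            ≤ ENNReal.ofReal C *
                (wSob (s - 2) (δ + 1) (ellOp a₂ a₁ a₀ u) + sobBall (s - 2) (2 * r) u) := by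
  obtain ⟨m, rfl⟩ : ∃ m, s₀ = m + 2 := ⟨s₀ - 2, by omega⟩
  obtain ⟨n, rfl⟩ : ∃ n, s = n + 2 := ⟨s - 2, by omega⟩
  set K : ENNReal := 4 ^ (m + 3) * ENNReal.ofReal M ^ 2
  have hK : K ≠ ⊤ := by finiteness
  have hKle : ∀ {k : ℕ} {t : ℝ} {f : EuclideanSpace ℝ (Fin 3) → ℝ}, k ≤ m + 3 →
      ContDiff ℝ (⊤ : ℕ∞) f → wSob k t f ≤ ENNReal.ofReal M → WeightedSobolev.wNorm k t f ≤ K :=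
    fun hk hf hw => (WeightedSobolev.wNorm_le_wSob_sq _ _ hf).trans
      (mul_le_mul' (pow_le_pow_right₀ (by norm_num) hk) (pow_le_pow_left' hw 2))
  obtain ⟨C, r, hC, hr, h⟩ := WeightedSobolev.wNorm_le_diffOp_add_ball (m := m) (n := n)
    (d := δ₀) (τ := δ - 1) (by omega) (by omega) (by linarith) hK hlam (by linarith) (by linarith)
  set D : ENNReal := 4 ^ (n + 2) * (C * 4 ^ n)
  have hD : D ^ (1 / 2 : ℝ) ≠ ⊤ := by finiteness
  refine ⟨(D ^ (1 / 2 : ℝ)).toReal + 1, r / 2, by positivity, by positivity, ?_⟩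
  intro a₂ a₁ a₀ ha₂ ha₁ ha₀ _ hell hn₂ hn₁ hn₀ u hu hfin
  have hc : WeightedSobolev.CoefBound m δ₀ K (fun i j x => a₂ x i j) (fun i x => a₁ x i) a₀ :=
    ⟨ha₂, ha₁, ha₀, fun i j => hKle le_rfl ((ha₂ i j).sub contDiff_const) (hn₂ i j),
      fun i => hKle (by omega) (ha₁ i) (hn₁ i), hKle (by omega) ha₀ hn₀⟩
  have hL := WeightedSobolev.smooth_diffOp hc.smooth_a hc.smooth_b hc.smooth_c hu
  have hN : WeightedSobolev.wNorm (n + 2) (δ - 1) u < ⊤ :=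
    (WeightedSobolev.wNorm_le_wSob_sq _ _ hu).trans_lt
      (ENNReal.mul_lt_top (by finiteness) (ENNReal.pow_lt_top hfin))
  have key := h _ _ _ hc (fun x ξ => by
    simpa [EuclideanSpace.real_norm_sq_eq] using (hell x (WithLp.toLp 2 ξ)).1) u hu hN
  rw [show δ - 1 + 2 = δ + 1 by ring] at key
  rw [show 2 * (r / 2) = r by ring]
  have main : wSob (n + 2) (δ - 1) u ^ 2 ≤
      D * (wSob n (δ + 1) (ellOp a₂ a₁ a₀ u) ^ 2 + sobBall n r u ^ 2) := by
    refine (WeightedSobolev.wSob_sq_le_wNorm _ _ hu).trans ?_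
    simp only [D]
    rw [mul_assoc, mul_assoc]
    refine mul_le_mul_right (key.trans (mul_le_mul_right ?_ C)) _
    rw [mul_add]
    refine add_le_add (WeightedSobolev.wNorm_le_wSob_sq _ _ hL) ?_
    exact (WeightedSobolev.lintegral_ball_sq_le_sobBall_sq n r u).trans
      (le_mul_of_one_le_left zero_le (one_le_pow₀ (by norm_num)))
  refine (WeightedSobolev.le_rpow_half_mul_add main).trans (mul_le_mul_left ?_ _)
  rw [← ENNReal.ofReal_toReal hD]
  exact ENNReal.ofReal_le_ofReal (by simp)
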